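/- Fused antisymmetrizer identity for R̂: for 2 ≤ k ≤ N and generic ξ ∈ ℂ, on (ℂ^N)^{⊗(k+1)} with tensor factors labelled 1, …, k, 0, one has R̂₁₀(z) · R̂₂₀(q^{−1}z) ⋯ R̂_{k0}(q^{1−k}z) · A_k = A_k · R̂₁₀(z) · R̂₂₀(q^{−1}z) ⋯ R̂_{k0}(q^{1−k}z) · A_k, where R̂_{i0}(w) denotes R̂ evaluated at argument w (i.e. at ξ + (1−i)ζ for w = q^{1−i}z) acting on factors i and 0 and as the identity elsewhere, and A_k is the antisymmetrizer acting on factors 1, …, k and as the identity on factor 0. -/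

import Mathlib

open Complex Matrix Kronecker

noncomputable section

/-- `eπ x = exp(iπx)`; the variables `z, q, p` of the paper are `eπ ξ, eπ ζ, eπ (2τ)`. -/
def eπ (x : ℂ) : ℂ := Complex.exp (Real.pi * Complex.I * x)

/-- Jacobi theta function with characteristics `ϑ[γ₁,γ₂](u,τ)`. -/
def jTheta (γ₁ γ₂ : ℝ) (u τ : ℂ) : ℂ :=
  ∑' m : ℤ, Complex.exp (Real.pi * Complex.I * ((m : ℂ) + (γ₁ : ℂ)) ^ 2 * τ +
    2 * Real.pi * Complex.I * ((m : ℂ) + (γ₁ : ℂ)) * (u + (γ₂ : ℂ)))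

/-- single infinite Pochhammer symbol `(x;s)_∞`. -/
def poch1 (x s : ℂ) : ℂ := ∏' n : ℕ, (1 - x * s ^ n)

/-- double infinite Pochhammer symbol `(x;p₁,p₂)_∞`. -/
def poch2 (x p₁ p₂ : ℂ) : ℂ := ∏' n : ℕ × ℕ, (1 - x * p₁ ^ n.1 * p₂ ^ n.2)

/-- Jacobi `Θ_s(x)` function. -/
def ThetaF (s x : ℂ) : ℂ := poch1 x s * poch1 (s * x⁻¹) s * poch1 s s

/-- numerator of `1/κ(z²)`, with `z = eπ ξ`, `q = eπ ζ`, `p = eπ (2τ)`. -/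
def kappaNum (N : ℕ) (ξ ζ τ : ℂ) : ℂ :=
  poch2 (eπ (2 * N * ζ - 2 * ξ)) (eπ (2 * τ)) (eπ (2 * N * ζ)) *
  poch2 (eπ (2 * ζ + 2 * ξ)) (eπ (2 * τ)) (eπ (2 * N * ζ)) *
  poch2 (eπ (2 * τ - 2 * ξ)) (eπ (2 * τ)) (eπ (2 * N * ζ)) *
  poch2 (eπ (2 * τ + (2 * N - 2) * ζ + 2 * ξ)) (eπ (2 * τ)) (eπ (2 * N * ζ))

/-- denominator of `1/κ(z²)`: the numerator with `ξ → -ξ`. -/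
def kappaDen (N : ℕ) (ξ ζ τ : ℂ) : ℂ := kappaNum N (-ξ) ζ τ

/-- the diagonal matrix `g^{1/2}` with entries `e^{iπj/N}`, `1 ≤ j ≤ N`. -/
def gHalf (N : ℕ) : Matrix (Fin N) (Fin N) ℂ :=
  Matrix.diagonal fun j => eπ ((((j : ℕ) : ℂ) + 1) / N)

/-- the diagonal matrix `g` with entries `ω^j = e^{2iπj/N}`, `1 ≤ j ≤ N`. -/
def gMat (N : ℕ) : Matrix (Fin N) (Fin N) ℂ :=
  Matrix.diagonal fun j => eπ (2 * (((j : ℕ) : ℂ) + 1) / N)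

/-- the shift matrix `h`, `h_{jl} = δ_{j+1,l}` (mod `N`). -/
def hMat (N : ℕ) : Matrix (Fin N) (Fin N) ℂ :=
  Matrix.of fun j l => if (l : ℕ) = ((j : ℕ) + 1) % N then 1 else 0

/-- `I_{(α₁,α₂)} = g^{α₂} h^{α₁}`. -/
def Imat (N : ℕ) (α : Fin N × Fin N) : Matrix (Fin N) (Fin N) ℂ :=
  gMat N ^ (α.2 : ℕ) * hMat N ^ (α.1 : ℕ)

/-- the coefficient `W_{(α₁,α₂)}(ξ,ζ,τ)`. -/
def Wcoef (N : ℕ) (α : Fin N × Fin N) (ξ ζ τ : ℂ) : ℂ :=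
  jTheta (1/2 + (α.1 : ℕ) / N) (1/2 + (α.2 : ℕ) / N) (ξ + ζ / N) τ /
    (N * jTheta (1/2 + (α.1 : ℕ) / N) (1/2 + (α.2 : ℕ) / N) (ζ / N) τ)

/-- the matrix `𝒵(z)`, `z = eπ ξ`. -/
def Zmat (N : ℕ) (ξ ζ τ : ℂ) : Matrix (Fin N × Fin N) (Fin N × Fin N) ℂ :=
  (eπ (ξ * (2 / N - 2)) * (kappaNum N ξ ζ τ / kappaDen N ξ ζ τ) *
      jTheta (1/2) (1/2) ζ τ / jTheta (1/2) (1/2) (ξ + ζ) τ) •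
    ∑ α : Fin N × Fin N, Wcoef N α ξ ζ τ • (Imat N α ⊗ₖ (Imat N α)⁻¹)

/-- the Belavin R-matrix `R(z)`, as a function of `ξ` with `z = eπ ξ`. -/
def Rmat (N : ℕ) (ξ ζ τ : ℂ) : Matrix (Fin N × Fin N) (Fin N × Fin N) ℂ :=
  (gHalf N ⊗ₖ gHalf N) * Zmat N ξ ζ τ * (gHalf N ⊗ₖ gHalf N)⁻¹

/-- genericity: every theta-function value and κ-value appearing in a denominator is nonzero. -/
def Rgeneric (N : ℕ) (ξ ζ τ : ℂ) : Prop :=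
  jTheta (1/2) (1/2) (ξ + ζ) τ ≠ 0 ∧
  (∀ α : Fin N × Fin N,
    jTheta (1/2 + (α.1 : ℕ) / N) (1/2 + (α.2 : ℕ) / N) (ζ / N) τ ≠ 0) ∧
  kappaDen N ξ ζ τ ≠ 0

/-- the flip (permutation) operator `P` on `ℂ^N ⊗ ℂ^N`. -/
def Pflip (N : ℕ) : Matrix (Fin N × Fin N) (Fin N × Fin N) ℂ :=
  Matrix.of fun a b => if a.1 = b.2 ∧ a.2 = b.1 then 1 else 0

/-- partial transposition in the second tensor factor. -/
def pt2 {N : ℕ} (M : Matrix (Fin N × Fin N) (Fin N × Fin N) ℂ) :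
    Matrix (Fin N × Fin N) (Fin N × Fin N) ℂ :=
  Matrix.of fun a b => M (a.1, b.2) (b.1, a.2)

/-- `τ_N` evaluated at `eπ u` (all fractional powers via exponentials). -/
def tauNe (N : ℕ) (ζ u : ℂ) : ℂ :=
  eπ (u * (2 / N - 2)) * ThetaF (eπ (2 * N * ζ)) (eπ (ζ + 2 * u)) /
    ThetaF (eπ (2 * N * ζ)) (eπ (ζ - 2 * u))

/-- the normalized Belavin R-matrix `R̂(z) = τ_N(q^{1/2}z⁻¹) R(z)`, as a function of `ξ`. -/
def Rhat (N : ℕ) (ξ ζ τ : ℂ) : Matrix (Fin N × Fin N) (Fin N × Fin N) ℂ :=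
  tauNe N ζ (ζ / 2 - ξ) • Rmat N ξ ζ τ


/-- `M` acting on tensor factors `i` and `j` of a multiple tensor product and as
the identity on the remaining factors. -/
def act2 {N : ℕ} {ι : Type} [Fintype ι] [DecidableEq ι] (i j : ι)
    (M : Matrix (Fin N × Fin N) (Fin N × Fin N) ℂ) :
    Matrix (ι → Fin N) (ι → Fin N) ℂ :=
  Matrix.of fun a b =>
    (if ∀ l, l ≠ i → l ≠ j → a l = b l then 1 else 0) * M (a i, a j) (b i, b j)

/-- the antisymmetrizer `A_k` acting on the factors `1,…,k` of `(ℂ^N)^{⊗(k+1)}`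
(labelled `1,…,k,0`, factor `0` being the last one) and as the identity on factor `0`. -/
def asymExt (N k : ℕ) : Matrix (Fin (k+1) → Fin N) (Fin (k+1) → Fin N) ℂ :=
  (k.factorial : ℂ)⁻¹ • ∑ σ : Equiv.Perm (Fin k),
    (((Equiv.Perm.sign σ : ℤ) : ℂ)) •
      Matrix.of (fun a b =>
        if (∀ i : Fin k, a (Fin.castSucc i) = b (Fin.castSucc (σ.symm i))) ∧
            a (Fin.last k) = b (Fin.last k) then (1 : ℂ) else 0)

open scoped Topology

section

/-- permutation operator on a multiple tensor product -/
def Qp {N : ℕ} {ι : Type} [Fintype ι] [DecidableEq ι] (π : Equiv.Perm ι) :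
    Matrix (ι → Fin N) (ι → Fin N) ℂ :=
  Matrix.of fun a b => if b = a ∘ π then 1 else 0

section
variable {N : ℕ} {ι : Type} [Fintype ι] [DecidableEq ι]

lemma Qp_mul_apply (π : Equiv.Perm ι) (M : Matrix (ι → Fin N) (ι → Fin N) ℂ) (a b : ι → Fin N) :
    (Qp (N := N) π * M : Matrix (ι → Fin N) (ι → Fin N) ℂ) a b = M (a ∘ π) b := by
  simp [Qp, Matrix.mul_apply]

lemma mul_Qp_apply (π : Equiv.Perm ι) (M : Matrix (ι → Fin N) (ι → Fin N) ℂ) (a b : ι → Fin N) :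
    (M * Qp (N := N) π : Matrix (ι → Fin N) (ι → Fin N) ℂ) a b = M a (b ∘ π.symm) := by
  have : ∀ x : ι → Fin N, (b = x ∘ π) ↔ (x = b ∘ π.symm) := by
    intro x
    constructor
    · rintro rfl; ext i; simp
    · rintro rfl; ext i; simp
  simp [Qp, Matrix.mul_apply, this]

lemma Qp_mul (π ρ : Equiv.Perm ι) : (Qp π * Qp ρ : Matrix (ι → Fin N) (ι → Fin N) ℂ) = Qp (π * ρ) := by
  ext a b
  rw [Qp_mul_apply]
  simp only [Qp, Matrix.of_apply, Function.comp_assoc, Equiv.Perm.coe_mul]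
  rfl

lemma Qp_one : (Qp 1 : Matrix (ι → Fin N) (ι → Fin N) ℂ) = 1 := by
  ext a b
  simp [Qp, Matrix.one_apply, eq_comm]

/-- a permutation fixing both sites commutes with a two-site operator -/
lemma Qp_comm_act2 (π : Equiv.Perm ι) (i j : ι) (hi : π i = i) (hj : π j = j)
    (M : Matrix (Fin N × Fin N) (Fin N × Fin N) ℂ) :
    Qp (N := N) π * act2 i j M = act2 i j M * Qp (N := N) π := by
  ext a b
  rw [Qp_mul_apply, mul_Qp_apply]
  have hi' : π.symm i = i := by rw [Equiv.symm_apply_eq, hi]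
  have hj' : π.symm j = j := by rw [Equiv.symm_apply_eq, hj]
  simp only [act2, Matrix.of_apply, Function.comp, hi, hj, hi', hj']
  congr 1
  congr 1
  apply propext
  constructor
  · intro h l h1 h2
    have := h (π.symm l) (fun h => h1 (by rw [← hi, ← h]; simp)) (fun h => h2 (by rw [← hj, ← h]; simp))
    simpa using this
  · intro h l h1 h2
    have := h (π l) (fun h => h1 (by rw [← hi'] ; rw [← h]; simp)) (fun h => h2 (by rw [← hj']; rw [← h]; simp))
    simpa using this

/-- product of two two-site operators sharing the site `l` -/
lemma act2_mul_apply (i j l : ι) (hij : i ≠ j) (hil : i ≠ l) (hjl : j ≠ l)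
    (R R' : Matrix (Fin N × Fin N) (Fin N × Fin N) ℂ) (a b : ι → Fin N) :
    (act2 i l R * act2 j l R') a b =
      (if ∀ m, m ≠ i → m ≠ j → m ≠ l → a m = b m then 1 else 0) *
        ∑ x, R (a i, a l) (b i, x) * R' (a j, x) (b j, b l) := by
  rw [Matrix.mul_apply]
  let e : Fin N → (ι → Fin N) := fun x => Function.update (Function.update a i (b i)) l x
  have einj : Function.Injective e := by
    intro x y h
    have := congrFun h l
    simpa [e] using this
  rw [← Finset.sum_subset (Finset.subset_univ (Finset.univ.map ⟨e, einj⟩))]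
  · rw [Finset.sum_map, Finset.mul_sum]
    refine Finset.sum_congr rfl fun x _ => ?_
    simp only [act2, Matrix.of_apply, Function.Embedding.coeFn_mk, e]
    have h1 : ∀ m, m ≠ i → m ≠ l → a m = Function.update (Function.update a i (b i)) l x m := by
      intro m h1 h2
      simp [h1, h2]
    rw [if_pos h1]
    have h2 : (∀ m, m ≠ j → m ≠ l → Function.update (Function.update a i (b i)) l x m = b m) ↔
        (∀ m, m ≠ i → m ≠ j → m ≠ l → a m = b m) := by
      constructor
      · intro h m h1 h2 h3
        have := h m h2 h3
        simpa [h1, h3] using this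
      · intro h m h2 h3
        by_cases h1 : m = i
        · subst h1; simp [h3]
        · simpa [h1, h3] using h m h1 h2 h3
    simp only [h2]
    simp [hij.symm, hil, hjl]
    
  · intro c _ hc
    simp only [act2, Matrix.of_apply]
    by_cases h1 : ∀ m, m ≠ i → m ≠ l → a m = c m
    · by_cases h2 : ∀ m, m ≠ j → m ≠ l → c m = b m
      · exfalso
        apply hc
        rw [Finset.mem_map]
        refine ⟨c l, Finset.mem_univ _, ?_⟩
        ext m
        simp only [Function.Embedding.coeFn_mk, e]
        by_cases hm : m = l
        · subst hm; simp
        · by_cases hm' : m = i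
          · subst hm'; simp [hm, h2 m hij hil]
          · simp [hm, hm', h1 m hm' hm]
      · rw [if_neg h2]; simp
    · rw [if_neg h1]; simp

/-- the four-term relation for a pair of two-site operators -/
def FourTerm (R R' : Matrix (Fin N × Fin N) (Fin N × Fin N) ℂ) : Prop :=
  ∀ i1 i2 j1 j2 a c : Fin N,
    (∑ x, R (i1, a) (j1, x) * R' (i2, x) (j2, c)) + (∑ x, R (i2, a) (j1, x) * R' (i1, x) (j2, c))
    = (∑ x, R (i1, a) (j2, x) * R' (i2, x) (j1, c)) + (∑ x, R (i2, a) (j2, x) * R' (i1, x) (j1, c))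

lemma fourTerm_act2 (i j l : ι) (hij : i ≠ j) (hil : i ≠ l) (hjl : j ≠ l)
    (R R' : Matrix (Fin N × Fin N) (Fin N × Fin N) ℂ) (h : FourTerm R R') :
    (1 + Qp (Equiv.swap i j)) * (act2 i l R * act2 j l R') * (1 - Qp (Equiv.swap i j)) = 0 := by
  have hs : (Equiv.swap i j).symm = Equiv.swap i j := Equiv.symm_swap i j
  set s := Equiv.swap i j with hsdef
  have si : s i = j := Equiv.swap_apply_left i j
  have sj : s j = i := Equiv.swap_apply_right i j
  have sl : s l = l := Equiv.swap_apply_of_ne_of_ne hil.symm hjl.symm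
  have so : ∀ m, m ≠ i → m ≠ j → s m = m := fun m h1 h2 => Equiv.swap_apply_of_ne_of_ne h1 h2
  ext a b
  simp only [add_mul, mul_sub, one_mul, mul_one, Matrix.add_apply, Matrix.sub_apply, mul_Qp_apply,
    Qp_mul_apply, act2_mul_apply i j l hij hil hjl, hs, Function.comp, si, sj, sl, Matrix.zero_apply]
  have e1 : (∀ m, m ≠ i → m ≠ j → m ≠ l → a (s m) = b m) ↔ (∀ m, m ≠ i → m ≠ j → m ≠ l → a m = b m) := by
    refine forall_congr' fun m => forall_congr' fun h1 => forall_congr' fun h2 => ?_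
    rw [so m h1 h2]
  have e2 : (∀ m, m ≠ i → m ≠ j → m ≠ l → a m = b (s m)) ↔ (∀ m, m ≠ i → m ≠ j → m ≠ l → a m = b m) := by
    refine forall_congr' fun m => forall_congr' fun h1 => forall_congr' fun h2 => ?_
    rw [so m h1 h2]
  have e3 : (∀ m, m ≠ i → m ≠ j → m ≠ l → a (s m) = b (s m)) ↔ (∀ m, m ≠ i → m ≠ j → m ≠ l → a m = b m) := by
    refine forall_congr' fun m => forall_congr' fun h1 => forall_congr' fun h2 => ?_
    rw [so m h1 h2]
  simp only [e1, e2, e3]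
  have := h (a i) (a j) (b i) (b j) (a l) (b l)
  linear_combination (if ∀ m, m ≠ i → m ≠ j → m ≠ l → a m = b m then (1:ℂ) else 0) * this
end

/-- extension of a permutation of the first `k` sites, fixing the last one -/
def extP {k : ℕ} (σ : Equiv.Perm (Fin k)) : Equiv.Perm (Fin (k+1)) where
  toFun := Fin.lastCases (Fin.last k) (fun i => Fin.castSucc (σ i))
  invFun := Fin.lastCases (Fin.last k) (fun i => Fin.castSucc (σ.symm i))
  left_inv := by
    intro x; refine Fin.lastCases ?_ (fun i => ?_) x <;> simp
  right_inv := by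
    intro x; refine Fin.lastCases ?_ (fun i => ?_) x <;> simp

@[simp] lemma extP_last {k : ℕ} (σ : Equiv.Perm (Fin k)) : extP σ (Fin.last k) = Fin.last k := by
  simp [extP]
@[simp] lemma extP_castSucc {k : ℕ} (σ : Equiv.Perm (Fin k)) (i : Fin k) :
    extP σ (Fin.castSucc i) = Fin.castSucc (σ i) := by
  simp [extP]

lemma extP_mul {k : ℕ} (σ ρ : Equiv.Perm (Fin k)) : extP (σ * ρ) = extP σ * extP ρ := by
  ext x; refine Fin.lastCases ?_ (fun i => ?_) x <;> simp

lemma extP_one {k : ℕ} : extP (1 : Equiv.Perm (Fin k)) = 1 := by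
  ext x; refine Fin.lastCases ?_ (fun i => ?_) x <;> simp

lemma extP_swap {k : ℕ} (i j : Fin k) :
    extP (Equiv.swap i j) = Equiv.swap (Fin.castSucc i) (Fin.castSucc j) := by
  ext x
  refine Fin.lastCases ?_ (fun m => ?_) x
  · rw [extP_last, Equiv.swap_apply_of_ne_of_ne] <;> exact (Fin.castSucc_lt_last _).ne'
  · rw [extP_castSucc]
    simp only [Equiv.swap_apply_def, Fin.castSucc_inj]
    split_ifs <;> rfl

lemma asymExt_eq (N k : ℕ) : asymExt N k = (k.factorial : ℂ)⁻¹ • ∑ σ : Equiv.Perm (Fin k),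
    (((Equiv.Perm.sign σ : ℤ) : ℂ)) • Qp (extP σ) := by
  unfold asymExt
  congr 1
  refine Finset.sum_congr rfl fun σ _ => ?_
  congr 1
  ext a b
  simp only [Matrix.of_apply, Qp]
  congr 1
  apply propext
  constructor
  · rintro ⟨h1, h2⟩
    ext x
    refine Fin.lastCases ?_ (fun i => ?_) x
    · simp [h2]
    · simp [h1]
  · rintro rfl
    simp

lemma Qp_mul_asymExt (N k : ℕ) (σ : Equiv.Perm (Fin k)) :
    Qp (extP σ) * asymExt N k = ((Equiv.Perm.sign σ : ℤ) : ℂ) • asymExt N k := by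
  rw [asymExt_eq, Matrix.mul_smul, smul_comm]
  congr 1
  rw [Finset.mul_sum, Finset.smul_sum]
  refine Fintype.sum_equiv (Equiv.mulLeft σ) _ _ fun ρ => ?_
  simp only [Equiv.coe_mulLeft, Matrix.mul_smul, Qp_mul, extP_mul, smul_smul]
  congr 1
  rw [Equiv.Perm.sign_mul]
  push_cast
  rw [← mul_assoc, ← Int.cast_mul, ← Units.val_mul, Int.units_mul_self]
  simp

/-- the fusion identity from the four-term relations of consecutive factors -/
lemma fused_of_fourTerm (N k : ℕ) (R : Fin k → Matrix (Fin N × Fin N) (Fin N × Fin N) ℂ)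
    (h : ∀ (i : ℕ) (hi : i + 1 < k), FourTerm (R ⟨i, by omega⟩) (R ⟨i+1, hi⟩)) :
    (List.ofFn fun i : Fin k => act2 (Fin.castSucc i) (Fin.last k) (R i)).prod * asymExt N k =
      asymExt N k * (List.ofFn fun i : Fin k =>
        act2 (Fin.castSucc i) (Fin.last k) (R i)).prod * asymExt N k := by
  set f : Fin k → Matrix (Fin (k+1) → Fin N) (Fin (k+1) → Fin N) ℂ :=
    fun i => act2 (Fin.castSucc i) (Fin.last k) (R i) with hf
  set Pi := (List.ofFn f).prod with hPi
  set A := asymExt N k with hA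
  have key : ∀ (i : ℕ) (hi : i + 1 < k),
      Qp (extP (Equiv.swap (⟨i, by omega⟩ : Fin k) ⟨i+1, hi⟩)) * (Pi * A) = -(Pi * A) := by
    intro i hi
    set i0 : Fin k := ⟨i, by omega⟩ with hi0
    set i1 : Fin k := ⟨i+1, hi⟩ with hi1
    have hne : i0 ≠ i1 := by simp [hi0, hi1, Fin.ext_iff]
    set s := extP (Equiv.swap i0 i1) with hs
    have hsw : s = Equiv.swap (Fin.castSucc i0) (Fin.castSucc i1) := extP_swap i0 i1
    have dec : List.ofFn f = (List.ofFn f).take i ++ (f i0 :: f i1 :: (List.ofFn f).drop (i+2)) := by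
      conv_lhs => rw [← List.take_append_drop i (List.ofFn f)]
      congr 1
      rw [List.drop_eq_getElem_cons (by simp; omega), List.drop_eq_getElem_cons (by simp; omega)]
      simp [hi0, hi1]
    have commf : ∀ j : Fin k, j ≠ i0 → j ≠ i1 → Commute (Qp s) (f j) := by
      intro j h0 h1
      apply Qp_comm_act2
      · rw [hs, extP_castSucc, Equiv.swap_apply_of_ne_of_ne h0 h1]
      · rw [hs, extP_last]
    have c1 : Commute (Qp s) ((List.ofFn f).take i).prod := by
      apply Commute.list_prod_right
      intro x hx
      rw [List.mem_take_iff_getElem] at hx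
      obtain ⟨j, hj, rfl⟩ := hx
      simp only [List.getElem_ofFn]
      apply commf <;> simp [hi0, hi1, Fin.ext_iff] <;> simp at hj <;> omega
    have c2 : Commute (Qp s) ((List.ofFn f).drop (i+2)).prod := by
      apply Commute.list_prod_right
      intro x hx
      rw [List.mem_drop_iff_getElem] at hx
      obtain ⟨j, hj, rfl⟩ := hx
      simp only [List.getElem_ofFn]
      apply commf <;> simp [hi0, hi1, Fin.ext_iff] <;> omega
    have hP : Pi = ((List.ofFn f).take i).prod * (f i0 * f i1) * ((List.ofFn f).drop (i+2)).prod := by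
      rw [hPi]
      conv_lhs => rw [dec]
      simp only [List.prod_append, List.prod_cons, mul_assoc]
    have four : (1 + Qp s) * (f i0 * f i1) * (1 - Qp s) = 0 := by
      rw [hsw]
      apply fourTerm_act2 _ _ _ _ _ _ _ _ (h i hi)
      · exact fun h => hne (Fin.castSucc_injective _ h)
      · exact (Fin.castSucc_lt_last _).ne
      · exact (Fin.castSucc_lt_last _).ne
    have zero : (1 + Qp s) * Pi * (1 - Qp s) = 0 := by
      have c1' : Commute (1 + Qp s) ((List.ofFn f).take i).prod := (Commute.one_left _).add_left c1
      have c2' : Commute (1 - Qp s) ((List.ofFn f).drop (i+2)).prod := (Commute.one_left _).sub_left c2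
      rw [hP]
      calc _ = ((1 + Qp s) * ((List.ofFn f).take i).prod) * (f i0 * f i1) *
                (((List.ofFn f).drop (i+2)).prod * (1 - Qp s)) := by simp only [mul_assoc]
        _ = ((List.ofFn f).take i).prod * ((1 + Qp s) * (f i0 * f i1) * (1 - Qp s)) *
              ((List.ofFn f).drop (i+2)).prod := by
            rw [c1'.eq, ← c2'.eq]; simp only [mul_assoc]
        _ = 0 := by rw [four]; simp
    have hQA : Qp s * A = -A := by
      rw [hs, hA, Qp_mul_asymExt, Equiv.Perm.sign_swap hne]; simp
    have h2 : (1 - Qp s) * A = (2:ℂ) • A := by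
      rw [sub_mul, hQA, one_mul, sub_neg_eq_add, two_smul]
    have h3 : (1 + Qp s) * Pi * ((1 - Qp s) * A) = 0 := by
      rw [← mul_assoc, zero, zero_mul]
    rw [h2, Matrix.mul_smul, smul_eq_zero] at h3
    have h4 := h3.resolve_left two_ne_zero
    rw [add_mul, add_mul, one_mul, mul_assoc] at h4
    exact eq_neg_of_add_eq_zero_right h4
  have all : ∀ σ : Equiv.Perm (Fin k),
      Qp (extP σ) * (Pi * A) = ((Equiv.Perm.sign σ : ℤ) : ℂ) • (Pi * A) := by
    rcases k with _ | k
    · intro σ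
      have : σ = 1 := Subsingleton.elim _ _
      subst this
      simp [extP_one, Qp_one]
    intro σ
    have hσ : σ ∈ Submonoid.closure (Set.range fun i : Fin k ↦ Equiv.swap i.castSucc i.succ) := by
      rw [Equiv.Perm.mclosure_swap_castSucc_succ]; trivial
    induction hσ using Submonoid.closure_induction with
    | mem x hx =>
      obtain ⟨i, rfl⟩ := hx
      have := key i.1 (by omega)
      have e0 : (⟨i.1, by omega⟩ : Fin (k+1)) = i.castSucc := rfl
      have e1 : (⟨i.1+1, by omega⟩ : Fin (k+1)) = i.succ := rfl
      rw [e0, e1] at this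
      rw [this, Equiv.Perm.sign_swap (Fin.castSucc_lt_succ).ne]
      simp
    | one => simp [extP_one, Qp_one]
    | mul x y _ _ hx hy =>
      rw [extP_mul, ← Qp_mul, mul_assoc, hy, Matrix.mul_smul, hx, smul_smul, Equiv.Perm.sign_mul]
      push_cast
      rw [mul_comm]
  have fin : A * (Pi * A) = Pi * A := by
    have e : A * (Pi * A) = ((k.factorial : ℂ)⁻¹ • ∑ σ : Equiv.Perm (Fin k),
        (((Equiv.Perm.sign σ : ℤ) : ℂ)) • Qp (extP σ)) * (Pi * A) := by
      congr 1; rw [hA, asymExt_eq]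
    rw [e, Matrix.smul_mul, Finset.sum_mul]
    simp only [Matrix.smul_mul, all, smul_smul]
    have : ∀ σ : Equiv.Perm (Fin k), ((Equiv.Perm.sign σ : ℤ) : ℂ) * ((Equiv.Perm.sign σ : ℤ) : ℂ) = 1 := by
      intro σ
      rw [← Int.cast_mul, ← Units.val_mul, Int.units_mul_self]; simp
    simp only [this, one_smul, Finset.sum_const, Finset.card_univ, Fintype.card_perm, Fintype.card_fin]
    rw [← Nat.cast_smul_eq_nsmul ℂ, smul_smul, inv_mul_cancel₀ (by exact_mod_cast k.factorial_ne_zero), one_smul]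
  rw [mul_assoc, fin]
end

section

/-- the odd theta function -/
def th (u τ : ℂ) : ℂ := jTheta (1/2) (1/2) u τ

/-- Fourier coefficients of the odd theta function -/
def tc (τ : ℂ) (m : ℤ) : ℂ := cexp (Real.pi * I * ((m:ℂ) + 1/2) ^ 2 * τ + Real.pi * I * ((m:ℂ) + 1/2))

lemma tc_ne_zero (τ : ℂ) (m : ℤ) : tc τ m ≠ 0 := Complex.exp_ne_zero _

lemma th_term (u τ : ℂ) (m : ℤ) :
    cexp (Real.pi * I * ((m : ℂ) + ((1/2 : ℝ) : ℂ)) ^ 2 * τ +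
      2 * Real.pi * I * ((m : ℂ) + ((1/2:ℝ) : ℂ)) * (u + ((1/2:ℝ) : ℂ))) =
    tc τ m * cexp (2 * Real.pi * I * ((m:ℂ) + 1/2) * u) := by
  rw [tc, ← Complex.exp_add]
  congr 1
  push_cast
  ring

lemma th_eq_tsum (u τ : ℂ) : th u τ = ∑' m : ℤ, tc τ m * cexp (2 * Real.pi * I * ((m:ℂ) + 1/2) * u) := by
  unfold th jTheta
  exact tsum_congr fun m => th_term u τ m

lemma th_term_J (u τ : ℂ) (m : ℤ) : tc τ m * cexp (2 * Real.pi * I * ((m:ℂ) + 1/2) * u) =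
    cexp (Real.pi * I * τ / 4 + Real.pi * I * (u + 1/2)) * jacobiTheta₂_term m (u + 1/2 + τ/2) τ := by
  rw [tc, jacobiTheta₂_term, ← Complex.exp_add, ← Complex.exp_add]
  congr 1
  ring

lemma th_hasSum (u : ℂ) {τ : ℂ} (hτ : 0 < τ.im) :
    HasSum (fun m : ℤ => tc τ m * cexp (2 * Real.pi * I * ((m:ℂ) + 1/2) * u)) (th u τ) := by
  rw [th_eq_tsum]
  apply Summable.hasSum
  simp only [th_term_J]
  exact ((hasSum_jacobiTheta₂_term _ hτ).summable).mul_left _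

lemma th_eq_J (u τ : ℂ) : th u τ =
    cexp (Real.pi * I * τ / 4 + Real.pi * I * (u + 1/2)) * jacobiTheta₂ (u + 1/2 + τ/2) τ := by
  rw [th_eq_tsum, jacobiTheta₂, ← tsum_mul_left]
  exact tsum_congr fun m => th_term_J u τ m

lemma th_differentiable {τ : ℂ} (hτ : 0 < τ.im) : Differentiable ℂ (fun u => th u τ) := by
  simp only [th_eq_J]
  have h : Differentiable ℂ (fun z => jacobiTheta₂ z τ) := fun z => differentiableAt_jacobiTheta₂_fst z hτ
  have h2 : Differentiable ℂ (fun u : ℂ => jacobiTheta₂ (u + 1/2 + τ/2) τ) :=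
    h.comp (f := fun u : ℂ => u + 1/2 + τ/2) (by fun_prop)
  exact Differentiable.mul (by fun_prop) h2

lemma th_add_int_tau (u τ : ℂ) (n : ℤ) : th (u + n * τ) τ =
    cexp (-(Real.pi * I * n ^ 2 * τ) - 2 * Real.pi * I * n * (u + 1/2)) * th u τ := by
  rw [th_eq_tsum, th_eq_tsum, ← tsum_mul_left, ← (Equiv.addRight n).tsum_eq (fun m : ℤ => cexp (-(Real.pi * I * n ^ 2 * τ) - 2 * Real.pi * I * n * (u + 1/2)) * (tc τ m * cexp (2 * Real.pi * I * ((m:ℂ) + 1/2) * u)))]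
  refine tsum_congr fun m => ?_
  simp only [Equiv.coe_addRight, tc, ← Complex.exp_add]
  congr 1
  push_cast
  ring

lemma th_neg (u τ : ℂ) : th (-u) τ = - th u τ := by
  rw [th_eq_tsum, th_eq_tsum, ← tsum_neg, ← (Equiv.subLeft (-1:ℤ)).tsum_eq]
  refine tsum_congr fun m => ?_
  simp only [Equiv.subLeft_apply, tc, ← Complex.exp_add]
  rw [← neg_one_mul (cexp _), ← Complex.exp_pi_mul_I, ← Complex.exp_add, Complex.exp_eq_exp_iff_exists_int]
  refine ⟨-m-1, ?_⟩
  push_cast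
  ring

lemma th_zero (τ : ℂ) : th 0 τ = 0 := by
  have h := th_neg 0 τ
  rw [neg_zero] at h
  exact self_eq_neg.mp h

lemma jTheta_char (a b : ℝ) (w τ : ℂ) : jTheta (1/2 + a) (1/2 + b) w τ =
    cexp (Real.pi * I * a ^ 2 * τ + 2 * Real.pi * I * a * (w + 1/2 + b)) * th (w + a * τ + b) τ := by
  rw [th_eq_tsum, jTheta, ← tsum_mul_left]
  refine tsum_congr fun m => ?_
  simp only [tc, ← Complex.exp_add]
  congr 1
  push_cast
  ring

lemma jTheta_add_one (a b : ℝ) (n : ℤ) (w τ : ℂ) : jTheta (a + n) b w τ = jTheta a b w τ := by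
  unfold jTheta
  rw [← (Equiv.addRight n).tsum_eq (fun m : ℤ => cexp (Real.pi * I * ((m : ℂ) + (a : ℂ)) ^ 2 * τ +
    2 * Real.pi * I * ((m : ℂ) + (a : ℂ)) * (w + (b : ℂ))))]
  refine tsum_congr fun m => ?_
  simp only [Equiv.coe_addRight]
  congr 1
  push_cast
  ring

/-- even level-two theta -/
def thE (τ x : ℂ) : ℂ := ∑' p : ℤ, cexp (2 * Real.pi * I * (p:ℂ)^2 * τ + 4 * Real.pi * I * p * x)
/-- odd level-two theta -/
def thO (τ x : ℂ) : ℂ := ∑' p : ℤ, cexp (2 * Real.pi * I * ((p:ℂ) + 1/2)^2 * τ + 4 * Real.pi * I * (p + 1/2) * x)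

lemma thE_summable {τ : ℂ} (hτ : 0 < τ.im) (x : ℂ) :
    Summable fun p : ℤ => cexp (2 * Real.pi * I * (p:ℂ)^2 * τ + 4 * Real.pi * I * p * x) := by
  have h2 : 0 < (2 * τ).im := by simp [hτ]
  refine ((hasSum_jacobiTheta₂_term (2 * x) h2).summable).congr fun p => ?_
  rw [jacobiTheta₂_term]; congr 1; ring

lemma thO_summable {τ : ℂ} (hτ : 0 < τ.im) (x : ℂ) :
    Summable fun p : ℤ => cexp (2 * Real.pi * I * ((p:ℂ) + 1/2)^2 * τ + 4 * Real.pi * I * (p + 1/2) * x) := by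
  have h2 : 0 < (2 * τ).im := by simp [hτ]
  refine (((hasSum_jacobiTheta₂_term (2 * x + τ) h2).summable).mul_left (cexp (Real.pi * I * τ / 2 + 2 * Real.pi * I * x))).congr fun p => ?_
  rw [jacobiTheta₂_term, ← Complex.exp_add]; congr 1; ring

/-- the parity splitting of pairs of integers -/
def parEquiv : (ℤ × ℤ) ⊕ (ℤ × ℤ) ≃ ℤ × ℤ where
  toFun := Sum.elim (fun p => (p.1 + p.2, p.1 - p.2 - 1)) (fun p => (p.1 + p.2, p.1 - p.2))
  invFun := fun p => if (p.1 + p.2) % 2 = 0 then Sum.inr ((p.1 + p.2) / 2, (p.1 - p.2) / 2)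
    else Sum.inl ((p.1 + p.2 + 1) / 2, (p.1 - p.2 - 1) / 2)
  left_inv := by
    rintro (⟨a, b⟩ | ⟨a, b⟩)
    · change (if (a + b + (a - b - 1)) % 2 = 0 then Sum.inr ((a + b + (a - b - 1)) / 2, (a + b - (a - b - 1)) / 2)
        else Sum.inl ((a + b + (a - b - 1) + 1) / 2, (a + b - (a - b - 1) - 1) / 2)) = Sum.inl (a, b)
      rw [if_neg (by omega)]
      congr 1
      ext <;> simp <;> omega
    · change (if (a + b + (a - b)) % 2 = 0 then Sum.inr ((a + b + (a - b)) / 2, (a + b - (a - b)) / 2)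
        else Sum.inl ((a + b + (a - b) + 1) / 2, (a + b - (a - b) - 1) / 2)) = Sum.inr (a, b)
      rw [if_pos (by omega)]
      congr 1
      ext <;> simp <;> omega
  right_inv := by
    rintro ⟨a, b⟩
    by_cases h : (a + b) % 2 = 0
    · simp only [h, if_true, Sum.elim_inr]
      ext <;> simp <;> omega
    · simp only [h, if_false, Sum.elim_inl]
      ext <;> simp <;> omega

lemma th_mul_th {τ : ℂ} (hτ : 0 < τ.im) (x y : ℂ) :
    th (x + y) τ * th (x - y) τ = thE τ x * thO τ y - thO τ x * thE τ y := by
  have s1 := (th_hasSum (x + y) hτ)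
  have s2 := (th_hasSum (x - y) hτ)
  have n1 := s1.summable.norm
  have n2 := s2.summable.norm
  have p := summable_mul_of_summable_norm n1 n2
  have e1 := tsum_mul_tsum_of_summable_norm n1 n2
  rw [s1.tsum_eq, s2.tsum_eq] at e1
  rw [e1, ← parEquiv.tsum_eq]
  rw [← parEquiv.summable_iff] at p
  have pl := p.comp_injective Sum.inl_injective
  have pr := p.comp_injective Sum.inr_injective
  have := (HasSum.sum pl.hasSum pr.hasSum).tsum_eq
  have e2 := tsum_mul_tsum_of_summable_norm (thE_summable hτ x).norm (thO_summable hτ y).norm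
  have e3 := tsum_mul_tsum_of_summable_norm (thO_summable hτ x).norm (thE_summable hτ y).norm
  unfold thE thO
  rw [e2, e3, sub_eq_add_neg (∑' z : ℤ × ℤ, _), ← tsum_neg]
  refine this.trans ?_
  congr 1
  · refine tsum_congr ?_
    rintro ⟨a, b⟩
    simp only [Function.comp, parEquiv, Equiv.coe_fn_mk, Sum.elim_inl, tc, ← Complex.exp_add]
    rw [Complex.exp_eq_exp_iff_exists_int]
    refine ⟨a, ?_⟩
    push_cast
    ring
  · refine tsum_congr ?_
    rintro ⟨a, b⟩
    simp only [Function.comp, parEquiv, Equiv.coe_fn_mk, Sum.elim_inr, tc, ← Complex.exp_add]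
    rw [← neg_one_mul, ← Complex.exp_pi_mul_I, ← Complex.exp_add, Complex.exp_eq_exp_iff_exists_int]
    refine ⟨a, ?_⟩
    push_cast
    ring

lemma weierstrass {τ : ℂ} (hτ : 0 < τ.im) (x y z t : ℂ) :
    th (x + y) τ * th (x - y) τ * (th (z + t) τ * th (z - t) τ)
    - th (x + z) τ * th (x - z) τ * (th (y + t) τ * th (y - t) τ)
    + th (x + t) τ * th (x - t) τ * (th (y + z) τ * th (y - z) τ) = 0 := by
  simp only [th_mul_th hτ]
  ring
end

section

/-- coefficients of the Kronecker series -/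
def gk (τ v : ℂ) (n : ℤ) : ℂ := (1 - cexp (2 * Real.pi * I * (v + n * τ)))⁻¹

/-- `v` is not in the lattice -/
def Good (τ v : ℂ) : Prop := ∀ n : ℤ, cexp (2 * Real.pi * I * (v + n * τ)) ≠ 1

/-- the Heaviside function -/
def Hv (n : ℤ) : ℂ := if 0 ≤ n then 1 else 0

/-- the constant in the Kronecker identity -/
def Kc (τ : ℂ) : ℂ := ∑' k : ℤ, ∑' m : ℤ, tc τ m * Hv (k - m)

lemma norm_e (x : ℂ) : ‖cexp (2 * Real.pi * I * x)‖ = Real.exp (-2 * Real.pi * x.im) := by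
  rw [Complex.norm_exp]; congr 1; simp

lemma rlt {τ : ℂ} (hτ : 0 < τ.im) : Real.exp (-2 * Real.pi * τ.im) < 1 := by
  rw [Real.exp_lt_one_iff]
  have := Real.pi_pos
  nlinarith [mul_pos this hτ]

lemma e_split (τ v : ℂ) (n : ℤ) : cexp (2 * Real.pi * I * (v + n * τ)) =
    cexp (2 * Real.pi * I * v) * cexp (2 * Real.pi * I * τ) ^ n := by
  rw [← Complex.exp_int_mul, ← Complex.exp_add]; congr 1; ring

lemma gk_bound {τ v : ℂ} (hτ : 0 < τ.im) (hv : Good τ v) : ∃ C : ℝ, 0 ≤ C ∧ ∀ n : ℕ,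
    ‖gk τ v n‖ ≤ C ∧ ‖gk τ v (-n)‖ ≤ C * Real.exp (-2 * Real.pi * τ.im) ^ n ∧
    ‖gk τ v n - 1‖ ≤ C * Real.exp (-2 * Real.pi * τ.im) ^ n := by
  set q := cexp (2 * Real.pi * I * τ) with hq
  set Y := cexp (2 * Real.pi * I * v) with hY
  have hYne : Y ≠ 0 := Complex.exp_ne_zero _
  have hqne : q ≠ 0 := Complex.exp_ne_zero _
  have hqn : ‖q‖ = Real.exp (-2 * Real.pi * τ.im) := norm_e τ
  have hq1 : ‖q‖ < 1 := hqn ▸ rlt hτ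
  have hqt : Filter.Tendsto (fun n : ℕ => q ^ n) Filter.atTop (𝓝 0) :=
    tendsto_pow_atTop_nhds_zero_of_norm_lt_one hq1
  have t1 : Filter.Tendsto (fun n : ℕ => (1 - Y * q ^ n)⁻¹) Filter.atTop (𝓝 ((1 - Y * 0)⁻¹)) :=
    (tendsto_const_nhds.sub (tendsto_const_nhds.mul hqt)).inv₀ (by simp)
  have t2 : Filter.Tendsto (fun n : ℕ => (q ^ n - Y)⁻¹) Filter.atTop (𝓝 ((0 - Y)⁻¹)) :=
    (hqt.sub tendsto_const_nhds).inv₀ (by simpa using hYne)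
  obtain ⟨C1, h1⟩ := (Metric.isBounded_range_of_tendsto _ t1).exists_norm_le
  obtain ⟨C2, h2⟩ := (Metric.isBounded_range_of_tendsto _ t2).exists_norm_le
  have h1' : ∀ n : ℕ, ‖(1 - Y * q ^ n)⁻¹‖ ≤ C1 := fun n => h1 _ ⟨n, rfl⟩
  have h2' : ∀ n : ℕ, ‖(q ^ n - Y)⁻¹‖ ≤ C2 := fun n => h2 _ ⟨n, rfl⟩
  have p1 : 0 ≤ C1 := (norm_nonneg _).trans (h1' 0)
  have p2 : 0 ≤ C2 := (norm_nonneg _).trans (h2' 0)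
  have g1 : ∀ n : ℕ, gk τ v n = (1 - Y * q ^ n)⁻¹ := by
    intro n; rw [gk, e_split]; simp [hY, hq]
  have g2 : ∀ n : ℕ, gk τ v (-n) = q ^ n * (q ^ n - Y)⁻¹ := by
    intro n
    have e := e_split τ v (-n)
    rw [_root_.zpow_neg, zpow_natCast, ← hY, ← hq] at e
    rw [gk, e]
    have hqn : q ^ n ≠ 0 := pow_ne_zero _ hqne
    have : 1 - Y * (q ^ n)⁻¹ = (q ^ n - Y) / q ^ n := by field_simp
    rw [this, inv_div, div_eq_mul_inv]
  have g3 : ∀ n : ℕ, gk τ v n - 1 = Y * q ^ n * gk τ v n := by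
    intro n
    have hg := hv n
    have : 1 - cexp (2 * Real.pi * I * (v + (n:ℤ) * τ)) ≠ 0 := sub_ne_zero.mpr hg.symm
    rw [gk]
    have e := e_split τ v n
    rw [zpow_natCast] at e
    rw [← hY, ← hq] at e
    rw [← e]
    field_simp
    ring
  refine ⟨C1 + C2 + ‖Y‖ * C1, by positivity, fun n => ⟨?_, ?_, ?_⟩⟩
  · rw [g1]
    have : 0 ≤ ‖Y‖ * C1 := by positivity
    linarith [h1' n]
  · rw [g2, norm_mul, norm_pow, hqn, mul_comm]
    gcongr
    have : 0 ≤ ‖Y‖ * C1 := by positivity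
    linarith [h2' n]
  · rw [g3, norm_mul, norm_mul, norm_pow, hqn, g1]
    have h : ‖Y‖ * ‖(1 - Y * q ^ n)⁻¹‖ ≤ C1 + C2 + ‖Y‖ * C1 := by
      have := mul_le_mul_of_nonneg_left (h1' n) (norm_nonneg Y)
      linarith
    have hr : 0 ≤ Real.exp (-2 * Real.pi * τ.im) ^ n := by positivity
    nlinarith [mul_le_mul_of_nonneg_right h hr]

lemma gk_bdd {τ v : ℂ} (hτ : 0 < τ.im) (hv : Good τ v) : ∃ C : ℝ, ∀ n : ℤ, ‖gk τ v n‖ ≤ C := by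
  obtain ⟨C, hC0, hC⟩ := gk_bound hτ hv
  refine ⟨C, fun n => ?_⟩
  obtain ⟨m, rfl | rfl⟩ := n.eq_nat_or_neg
  · exact (hC m).1
  · refine (hC m).2.1.trans ?_
    exact mul_le_of_le_one_right hC0 (pow_le_one₀ (Real.exp_nonneg _) (rlt hτ).le)

lemma ek_summable {τ v : ℂ} (hτ : 0 < τ.im) (hv : Good τ v) :
    Summable fun n : ℤ => ‖gk τ v n - Hv n‖ := by
  obtain ⟨C, hC0, hC⟩ := gk_bound hτ hv
  have hs : Summable fun n : ℕ => C * Real.exp (-2 * Real.pi * τ.im) ^ n :=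
    (summable_geometric_of_lt_one (Real.exp_nonneg _) (rlt hτ)).mul_left C
  rw [summable_int_iff_summable_nat_and_neg]
  constructor
  · refine Summable.of_nonneg_of_le (fun _ => norm_nonneg _) (fun n => ?_) hs
    simpa [Hv] using (hC n).2.2
  · rw [← summable_nat_add_iff 1]
    rw [← summable_nat_add_iff 1] at hs
    refine Summable.of_nonneg_of_le (fun _ => norm_nonneg _) (fun n => ?_) hs
    have : Hv (-((n + 1 : ℕ) : ℤ)) = 0 := by
      rw [Hv, if_neg]; push_cast; omega
    rw [this, sub_zero]
    exact (hC (n+1)).2.1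

lemma fk_summable {τ u v : ℂ} (hτ : 0 < τ.im) (hv : Good τ v) (hu : 0 < u.im) (hu2 : u.im < τ.im) :
    Summable fun n : ℤ => ‖cexp (2 * Real.pi * I * n * u) * gk τ v n‖ := by
  obtain ⟨C, hC0, hC⟩ := gk_bound hτ hv
  have hX : ∀ n : ℤ, cexp (2 * Real.pi * I * n * u) = cexp (2 * Real.pi * I * u) ^ n := by
    intro n
    rw [← Complex.exp_int_mul]; congr 1; ring
  simp only [hX, norm_mul, norm_zpow, norm_e]
  rw [summable_int_iff_summable_nat_and_neg]
  constructor
  · refine Summable.of_nonneg_of_le (fun _ => by positivity) (fun n => ?_)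
      ((summable_geometric_of_lt_one (Real.exp_nonneg _) (rlt hu)).mul_right C)
    rw [zpow_natCast]
    exact mul_le_mul_of_nonneg_left (hC n).1 (by positivity)
  · have hd : 0 < (τ - u).im := by simp [hu2]
    refine Summable.of_nonneg_of_le (fun _ => by positivity) (fun n => ?_)
      ((summable_geometric_of_lt_one (Real.exp_nonneg _) (rlt hd)).mul_right C)
    have e : Real.exp (-2 * Real.pi * (τ - u).im) ^ n =
        Real.exp (-2 * Real.pi * u.im) ^ (-(n:ℤ)) * Real.exp (-2 * Real.pi * τ.im) ^ n := by
      rw [_root_.zpow_neg, zpow_natCast, ← inv_pow, ← mul_pow, ← Real.exp_neg, ← Real.exp_add]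
      congr 2
      simp; ring
    rw [e]
    have hc := (hC n).2.1
    rw [mul_comm C] at hc
    exact (mul_le_mul_of_nonneg_left hc (zpow_nonneg (Real.exp_nonneg _) _)).trans_eq (mul_assoc _ _ _).symm

/-- the convolution theorem for two-sided series -/
lemma conv_hasSum {a b : ℤ → ℂ} (ha : Summable fun n => ‖a n‖) (hb : Summable fun n => ‖b n‖) :
    HasSum (fun k : ℤ => ∑' m : ℤ, a m * b (k - m)) ((∑' m, a m) * ∑' n, b n) := by
  have p := summable_mul_of_summable_norm ha hb
  have e := tsum_mul_tsum_of_summable_norm ha hb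
  rw [e]
  let E : ℤ × ℤ ≃ ℤ × ℤ :=
    { toFun := fun x => (x.2, x.1 - x.2)
      invFun := fun y => (y.1 + y.2, y.1)
      left_inv := by intro x; ext <;> simp
      right_inv := by intro x; ext <;> simp }
  have h := (E.hasSum_iff (f := fun x : ℤ × ℤ => a x.1 * b x.2)).mpr p.hasSum
  exact h.prod_fiberwise (f := (fun x : ℤ × ℤ => a x.1 * b x.2) ∘ E) (fun k => (h.summable.prod_factor k).hasSum)

lemma tc_summable {τ : ℂ} (hτ : 0 < τ.im) : Summable fun m => ‖tc τ m‖ := by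
  have := (th_hasSum 0 hτ).summable.norm
  simpa using this

lemma tc_tsum {τ : ℂ} (hτ : 0 < τ.im) : ∑' m, tc τ m = 0 := by
  have := (th_hasSum 0 hτ).tsum_eq
  simpa [th_zero] using this

lemma tc_succ (τ : ℂ) (m : ℤ) : tc τ (m+1) = -(cexp (2 * Real.pi * I * ((m + 1) * τ)) * tc τ m) := by
  rw [tc, tc, ← Complex.exp_add, ← neg_one_mul (cexp _), ← Complex.exp_pi_mul_I, ← Complex.exp_add]
  congr 1
  push_cast
  ring

/-- Fourier coefficients of theta times the Kronecker series -/
def ck (τ v : ℂ) (k : ℤ) : ℂ := ∑' m : ℤ, tc τ m * gk τ v (k - m)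

lemma ck_summable {τ v : ℂ} (hτ : 0 < τ.im) (hv : Good τ v) (k : ℤ) :
    Summable fun m : ℤ => tc τ m * gk τ v (k - m) := by
  obtain ⟨C, hC⟩ := gk_bdd hτ hv
  refine Summable.of_norm_bounded ((tc_summable hτ).mul_right C) fun m => ?_
  rw [norm_mul]
  exact mul_le_mul_of_nonneg_left (hC _) (norm_nonneg _)

lemma ck_succ {τ v : ℂ} (hτ : 0 < τ.im) (hv : Good τ v) (k : ℤ) :
    ck τ v (k+1) = -(cexp (2 * Real.pi * I * (v + (k + 1) * τ)) * ck τ v k) := by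
  have h1 : ck τ v (k+1) = ∑' m : ℤ, tc τ (m+1) * gk τ v (k - m) := by
    rw [ck, ← (Equiv.addRight (1:ℤ)).tsum_eq]
    refine tsum_congr fun m => ?_
    simp only [Equiv.coe_addRight]
    congr 2; ring
  have s1 : Summable fun m : ℤ => tc τ (m+1) * gk τ v (k - m) := by
    have := (Equiv.addRight (1:ℤ)).summable_iff.mpr (ck_summable hτ hv (k+1))
    refine this.congr fun m => ?_
    simp only [Function.comp, Equiv.coe_addRight]
    congr 2; ring
  have s2 := (ck_summable hτ hv k).mul_left (cexp (2 * Real.pi * I * (v + (k + 1) * τ)))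
  have s3 := s1.hasSum.add s2.hasSum
  rw [← h1, tsum_mul_left] at s3
  have h0 : HasSum (fun m : ℤ => tc τ (m+1)) 0 := by
    rw [← tc_tsum hτ]
    exact (Equiv.addRight (1:ℤ)).hasSum_iff.mpr ((tc_summable hτ).of_norm.hasSum)
  have : (fun m : ℤ => tc τ (m+1) * gk τ v (k - m) + cexp (2 * Real.pi * I * (v + (k + 1) * τ)) *
      (tc τ m * gk τ v (k - m))) = fun m : ℤ => tc τ (m+1) := by
    funext m
    have hne : 1 - cexp (2 * Real.pi * I * (v + (k - m : ℤ) * τ)) ≠ 0 := sub_ne_zero.mpr (hv _).symm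
    have e : cexp (2 * Real.pi * I * (v + (k + 1) * τ)) =
        cexp (2 * Real.pi * I * (v + (k - m : ℤ) * τ)) * cexp (2 * Real.pi * I * ((m + 1) * τ)) := by
      rw [← Complex.exp_add]; congr 1; push_cast; ring
    rw [e, tc_succ, gk]
    generalize cexp (2 * Real.pi * I * (v + (k - m : ℤ) * τ)) = w at *
    generalize cexp (2 * Real.pi * I * ((m + 1) * τ)) = E
    field_simp
    ring
  rw [this] at s3
  have := s3.unique h0
  rw [ck] at *
  exact eq_neg_of_add_eq_zero_left this

lemma ck_eq {τ v : ℂ} (hτ : 0 < τ.im) (hv : Good τ v) (k : ℤ) :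
    ck τ v k = ck τ v 0 / (tc τ 0 * cexp (Real.pi * I * v)) * (tc τ k * cexp (2 * Real.pi * I * ((k:ℂ) + 1/2) * v)) := by
  set d : ℤ → ℂ := fun k => ck τ v k / (tc τ k * cexp (2 * Real.pi * I * ((k:ℂ) + 1/2) * v)) with hd
  have step : ∀ k, d (k+1) = d k := by
    intro k
    simp only [hd]
    rw [ck_succ hτ hv, tc_succ]
    have e : cexp (2 * Real.pi * I * (((k+1:ℤ):ℂ) + 1/2) * v) = cexp (2 * Real.pi * I * v) * cexp (2 * Real.pi * I * ((k:ℂ) + 1/2) * v) := by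
      rw [← Complex.exp_add]; congr 1; push_cast; ring
    have e2 : cexp (2 * Real.pi * I * (v + (k + 1) * τ)) = cexp (2 * Real.pi * I * v) * cexp (2 * Real.pi * I * ((k + 1) * τ)) := by
      rw [← Complex.exp_add]; congr 1; ring
    rw [e, e2]
    have := tc_ne_zero τ k
    field_simp
  have const : ∀ k, d k = d 0 := by
    intro k
    induction k using Int.induction_on with
    | zero => rfl
    | succ n ih => rw [step, ih]
    | pred n ih => rw [← ih, ← step (-(n:ℤ) - 1)]; congr 1; ring
  have h := const k
  simp only [hd] at h
  rw [div_eq_iff (mul_ne_zero (tc_ne_zero _ _) (Complex.exp_ne_zero _))] at h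
  rw [h]
  congr 4
  push_cast; ring

lemma HasSum.congr_aux {f g : ℤ → ℂ} {a : ℂ} (h : HasSum f a) (e : ∀ k, g k = f k) : HasSum g a := by
  rw [funext e]; exact h

lemma ck_hasSum {τ v : ℂ} (hτ : 0 < τ.im) (hv : Good τ v) (u : ℂ) :
    HasSum (fun k : ℤ => ck τ v k * cexp (2 * Real.pi * I * ((k:ℂ) + 1/2) * u))
      (ck τ v 0 / (tc τ 0 * cexp (Real.pi * I * v)) * th (u + v) τ) := by
  have h := (th_hasSum (u + v) hτ).mul_left (ck τ v 0 / (tc τ 0 * cexp (Real.pi * I * v)))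
  refine HasSum.congr_aux h fun k => ?_
  rw [ck_eq hτ hv k]
  rw [mul_assoc, mul_assoc (tc τ k), ← Complex.exp_add]
  congr 4; ring

lemma ck_const {τ v : ℂ} (hτ : 0 < τ.im) (hv : Good τ v) :
    ck τ v 0 / (tc τ 0 * cexp (Real.pi * I * v)) * th v τ = Kc τ := by
  have h1 := ck_hasSum hτ hv 0
  simp only [mul_zero, Complex.exp_zero, mul_one, zero_add] at h1
  have h2 := conv_hasSum (tc_summable hτ) (ek_summable hτ hv)
  rw [tc_tsum hτ, zero_mul] at h2
  have h3 := h1.sub h2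
  rw [sub_zero] at h3
  rw [← h3.tsum_eq, Kc]
  refine tsum_congr fun k => ?_
  have sE : Summable fun m : ℤ => tc τ m * (gk τ v (k - m) - Hv (k - m)) := by
    obtain ⟨C, hC⟩ := gk_bdd hτ hv
    refine Summable.of_norm_bounded ((tc_summable hτ).mul_right (C + 1)) fun m => ?_
    rw [norm_mul]
    refine mul_le_mul_of_nonneg_left ((norm_sub_le _ _).trans (add_le_add (hC _) ?_)) (norm_nonneg _)
    unfold Hv; split_ifs <;> simp
  rw [ck, ← (ck_summable hτ hv k).tsum_sub sE]
  refine tsum_congr fun m => ?_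
  ring

/-- the Kronecker identity -/
lemma kron {τ u v : ℂ} (hτ : 0 < τ.im) (hv : Good τ v) (hu : 0 < u.im) (hu2 : u.im < τ.im) :
    th u τ * (∑' n : ℤ, cexp (2 * Real.pi * I * n * u) * gk τ v n) * th v τ = Kc τ * th (u + v) τ := by
  have h := conv_hasSum (th_hasSum u hτ).summable.norm (fk_summable hτ hv hu hu2)
  rw [(th_hasSum u hτ).tsum_eq] at h
  have h2 := ck_hasSum hτ hv u
  have e : (fun k : ℤ => ∑' m : ℤ, tc τ m * cexp (2 * Real.pi * I * ((m:ℂ) + 1/2) * u) *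
      (cexp (2 * Real.pi * I * (k - m : ℤ) * u) * gk τ v (k - m))) =
      fun k : ℤ => ck τ v k * cexp (2 * Real.pi * I * ((k:ℂ) + 1/2) * u) := by
    funext k
    rw [ck, ← tsum_mul_right]
    refine tsum_congr fun m => ?_
    have : cexp (2 * Real.pi * I * ((k:ℂ) + 1/2) * u) = cexp (2 * Real.pi * I * ((m:ℂ) + 1/2) * u) *
      cexp (2 * Real.pi * I * (k - m : ℤ) * u) := by
      rw [← Complex.exp_add]; congr 1; push_cast; ring
    rw [this]; ring
  rw [e] at h
  rw [h.unique h2, ← ck_const hτ hv]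
  ring
end

section

lemma tc_int {τ : ℂ} (hτ : 0 < τ.im) :
    ∫ x : ℝ in (0:ℝ)..1, cexp (-(Real.pi * I * x)) * th x τ = tc τ 0 := by
  have h := intervalIntegral.hasSum_integral_of_dominated_convergence (μ := MeasureTheory.volume)
    (a := (0:ℝ)) (b := 1)
    (F := fun (m : ℤ) (x : ℝ) => tc τ m * cexp (2 * Real.pi * I * m * x))
    (f := fun x : ℝ => cexp (-(Real.pi * I * x)) * th x τ)
    (fun m _ => ‖tc τ m‖) ?_ ?_ ?_ ?_ ?_
  · have e : ∀ m : ℤ, m ≠ 0 → ∫ x : ℝ in (0:ℝ)..1, tc τ m * cexp (2 * Real.pi * I * m * x) = 0 := by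
      intro m hm
      rw [intervalIntegral.integral_const_mul, integral_exp_mul_complex]
      · have : cexp (2 * Real.pi * I * m * (1:ℝ)) = 1 := by
          rw [Complex.exp_eq_one_iff]; exact ⟨m, by push_cast; ring⟩
        rw [this]; simp
      · simp [Real.pi_ne_zero, hm]
    have h2 := hasSum_single (f := fun m : ℤ => ∫ x : ℝ in (0:ℝ)..1, tc τ m * cexp (2 * Real.pi * I * m * x)) 0 e
    rw [h.unique h2]
    simp
  · intro m
    refine Continuous.aestronglyMeasurable ?_
    fun_prop
  · intro m
    refine Filter.Eventually.of_forall fun x _ => ?_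
    rw [norm_mul]
    have : ‖cexp (2 * Real.pi * I * m * x)‖ = 1 := by
      rw [Complex.norm_exp]; simp
    rw [this, mul_one]
  · exact Filter.Eventually.of_forall fun x _ => tc_summable hτ
  · exact intervalIntegrable_const
  · refine Filter.Eventually.of_forall fun x _ => ?_
    refine HasSum.congr_aux ((th_hasSum (x:ℂ) hτ).mul_left (cexp (-(Real.pi * I * x)))) fun m => ?_
    rw [mul_left_comm, ← Complex.exp_add]
    congr 2; ring

lemma th_not_zero {τ : ℂ} (hτ : 0 < τ.im) : ∃ u, th u τ ≠ 0 := by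
  by_contra! h
  have := tc_int hτ
  simp only [h, mul_zero, intervalIntegral.integral_zero] at this
  exact tc_ne_zero τ 0 this.symm

lemma th_eventually {τ : ℂ} (hτ : 0 < τ.im) (u₀ : ℂ) : ∀ᶠ u in 𝓝[≠] u₀, th u τ ≠ 0 := by
  have han : AnalyticOnNhd ℂ (fun u => th u τ) Set.univ :=
    fun z _ => ((th_differentiable hτ).analyticAt z)
  rcases (han u₀ trivial).eventually_eq_zero_or_eventually_ne_zero with h | h
  · exfalso
    obtain ⟨u, hu⟩ := th_not_zero hτ
    have := han.eq_of_eventuallyEq (g := fun _ => 0) (fun z _ => analyticAt_const) (z₀ := u₀) h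
    exact hu (congrFun this u)
  · exact h

lemma Kc_ne_zero {τ : ℂ} (hτ : 0 < τ.im) : Kc τ ≠ 0 := by
  intro hK
  set r := Real.exp (-2 * Real.pi * τ.im) with hr
  have hr1 : r < 1 := rlt hτ
  have hr0 : 0 < r := Real.exp_pos _
  set δ := (1 - r) / 2 with hδ
  have hδ0 : 0 < δ := by rw [hδ]; linarith
  set S := ∑' m : ℤ, ‖tc τ m‖ with hS
  -- the lower bound away from the origin
  have key : ∀ v : ℂ, ‖1 - cexp (2 * Real.pi * I * v)‖ < δ → ∀ n : ℤ, n ≠ 0 →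
      δ ≤ ‖1 - cexp (2 * Real.pi * I * (v + n * τ))‖ := by
    intro v hv n hn
    rw [e_split]
    set Y := cexp (2 * Real.pi * I * v)
    have hY1 : ‖Y‖ ≤ 1 + δ := by
      have : Y = 1 - (1 - Y) := by ring
      calc ‖Y‖ = ‖1 - (1 - Y)‖ := by rw [← this]
        _ ≤ ‖(1:ℂ)‖ + ‖1 - Y‖ := norm_sub_le _ _
        _ ≤ 1 + δ := by rw [norm_one]; linarith
    have hY2 : 1 - δ ≤ ‖Y‖ := by
      have := norm_sub_norm_le (1:ℂ) Y
      rw [norm_one] at this; linarith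
    have hnorm : ‖Y * cexp (2 * Real.pi * I * τ) ^ n‖ = ‖Y‖ * r ^ n := by
      rw [norm_mul, norm_zpow, norm_e τ]
    rcases lt_or_gt_of_ne hn with h | h
    · have h1 := norm_sub_norm_le (Y * cexp (2 * Real.pi * I * τ) ^ n) 1
      rw [norm_sub_rev, hnorm, norm_one] at h1
      have h2 : r⁻¹ ≤ r ^ n := by
        rw [← _root_.zpow_neg_one]
        exact zpow_le_zpow_right_of_le_one₀ hr0 hr1.le (by omega)
      have h3 : (1 - δ) * r⁻¹ ≤ ‖Y‖ * r ^ n := by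
        apply mul_le_mul hY2 h2 (by positivity) (by positivity)
      have h4 : 1 + δ ≤ (1 - δ) * r⁻¹ := by
        rw [le_mul_inv_iff₀ hr0, hδ]; nlinarith
      linarith
    · have h1 := norm_sub_norm_le 1 (Y * cexp (2 * Real.pi * I * τ) ^ n)
      rw [hnorm, norm_one] at h1
      have h2 : r ^ n ≤ r := by
        conv_rhs => rw [← zpow_one r]
        exact zpow_le_zpow_right_of_le_one₀ hr0 hr1.le (by omega)
      have h3 : ‖Y‖ * r ^ n ≤ (1 + δ) * r := by
        apply mul_le_mul hY1 h2 (by positivity) (by positivity)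
      nlinarith
  have bound : ∀ v : ℂ, ‖1 - cexp (2 * Real.pi * I * v)‖ < δ → cexp (2 * Real.pi * I * v) ≠ 1 →
      th v τ ≠ 0 → ‖tc τ 0‖ ≤ ‖1 - cexp (2 * Real.pi * I * v)‖ * δ⁻¹ * S := by
    intro v hv hv1 hthv
    have hG : Good τ v := by
      intro n
      by_cases hn : n = 0
      · subst hn; simpa using hv1
      · intro h
        have := key v hv n hn
        rw [h, sub_self, norm_zero] at this
        linarith
    have hc := ck_const hτ hG
    rw [hK, mul_eq_zero, or_iff_left hthv, div_eq_zero_iff,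
      or_iff_left (mul_ne_zero (tc_ne_zero _ _) (Complex.exp_ne_zero _))] at hc
    have hs := (ck_summable hτ hG 0).hasSum
    have hck : ∑' m : ℤ, tc τ m * gk τ v (0 - m) = 0 := hc
    rw [hck] at hs
    have hs2 := (hs.mul_left (1 - cexp (2 * Real.pi * I * v))).sub
      (hasSum_ite_eq (0:ℤ) (tc τ 0))
    rw [mul_zero, zero_sub] at hs2
    have hb := tsum_of_norm_bounded (((tc_summable hτ).mul_left (‖1 - cexp (2 * Real.pi * I * v)‖ * δ⁻¹)).hasSum)
      (f := fun m : ℤ => (1 - cexp (2 * Real.pi * I * v)) * (tc τ m * gk τ v (0 - m)) - if m = 0 then tc τ 0 else 0)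
      (fun m => ?_)
    · rw [hs2.tsum_eq, norm_neg, tsum_mul_left] at hb
      exact hb
    · by_cases hm : m = 0
      · subst hm
        have : 1 - cexp (2 * Real.pi * I * v) ≠ 0 := sub_ne_zero.mpr hv1.symm
        have e : gk τ v (0 - 0) = (1 - cexp (2 * Real.pi * I * v))⁻¹ := by simp [gk]
        rw [e, if_pos rfl, mul_left_comm, mul_inv_cancel₀ this, mul_one, sub_self, norm_zero]
        positivity
      · rw [if_neg hm, sub_zero, norm_mul, norm_mul, gk, norm_inv]
        have h1 := key v hv (0 - m) (by omega)
        have h2 : ‖1 - cexp (2 * Real.pi * I * (v + (0 - m : ℤ) * τ))‖⁻¹ ≤ δ⁻¹ := inv_anti₀ hδ0 h1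
        calc _ ≤ ‖1 - cexp (2 * Real.pi * I * v)‖ * (‖tc τ m‖ * δ⁻¹) := by gcongr
          _ = _ := by ring
  have ct : Filter.Tendsto (fun v : ℂ => ‖1 - cexp (2 * Real.pi * I * v)‖) (𝓝[≠] 0) (𝓝 0) := by
    have : Continuous (fun v : ℂ => ‖1 - cexp (2 * Real.pi * I * v)‖) := by fun_prop
    have := this.tendsto 0
    simp only [mul_zero, Complex.exp_zero, sub_self, norm_zero] at this
    exact this.mono_left nhdsWithin_le_nhds
  have ev1 := ct.eventually (gt_mem_nhds hδ0)
  have ev2 := th_eventually hτ 0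
  have ev3 : ∀ᶠ v : ℂ in 𝓝[≠] 0, cexp (2 * Real.pi * I * v) ≠ 1 := by
    have hb : ∀ᶠ v : ℂ in 𝓝[≠] 0, ‖v‖ < 1 := by
      have : Filter.Tendsto (fun v : ℂ => ‖v‖) (𝓝[≠] 0) (𝓝 0) := by
        have := (continuous_norm (E := ℂ)).tendsto 0
        rw [norm_zero] at this
        exact this.mono_left nhdsWithin_le_nhds
      exact this.eventually (gt_mem_nhds one_pos)
    filter_upwards [hb, self_mem_nhdsWithin] with v hv hv0 h
    rw [Complex.exp_eq_one_iff] at h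
    obtain ⟨n, hn⟩ := h
    have : v = n := by
      have h2 : (2 * Real.pi * I : ℂ) ≠ 0 := by simp [Real.pi_ne_zero]
      apply mul_left_cancel₀ h2; rw [hn]; ring
    rw [this] at hv
    have : n = 0 := by
      rw [Complex.norm_intCast] at hv
      have : |n| < 1 := by exact_mod_cast hv
      exact Int.abs_lt_one_iff.mp this
    apply hv0
    simp_all
  have ev : ∀ᶠ v : ℂ in 𝓝[≠] 0, ‖tc τ 0‖ ≤ ‖1 - cexp (2 * Real.pi * I * v)‖ * δ⁻¹ * S := by
    filter_upwards [ev1, ev2, ev3] with v h1 h2 h3 using bound v h1 h3 h2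
  have lim := (ct.mul_const δ⁻¹).mul_const S
  have := ge_of_tendsto lim ev
  rw [zero_mul, zero_mul] at this
  exact tc_ne_zero τ 0 (norm_le_zero_iff.mp this)
end

section

lemma th_add_one (u : ℂ) {τ : ℂ} (hτ : 0 < τ.im) : th (u + 1) τ = - th u τ := by
  refine (th_hasSum (u+1) hτ).unique (HasSum.congr_aux (th_hasSum u hτ).neg fun m => ?_)
  rw [← mul_neg]
  congr 1
  have : cexp (2 * Real.pi * I * ((m:ℂ) + 1/2) * (u + 1)) =
      cexp (2 * Real.pi * I * ((m:ℂ) + 1/2) * u) * (cexp (m * (2 * Real.pi * I)) * cexp (Real.pi * I)) := by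
    rw [← Complex.exp_add, ← Complex.exp_add]; congr 1; ring
  rw [this, Complex.exp_int_mul_two_pi_mul_I, Complex.exp_pi_mul_I]; ring

lemma th_int (k : ℤ) {τ : ℂ} (hτ : 0 < τ.im) : th k τ = 0 := by
  induction k using Int.induction_on with
  | zero => simpa using th_zero τ
  | succ n ih =>
    have := th_add_one (n:ℂ) hτ
    push_cast at *
    rw [this, ih, neg_zero]
  | pred n ih =>
    have := th_add_one (-(n:ℂ) - 1) hτ
    push_cast at *
    rw [sub_add_cancel, ih] at this
    exact neg_eq_zero.mp this.symm

lemma good_of_ne {τ v : ℂ} (hτ : 0 < τ.im) (hv : th v τ ≠ 0) : Good τ v := by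
  intro n h
  rw [Complex.exp_eq_one_iff] at h
  obtain ⟨k, hk⟩ := h
  have h2 : (2 * Real.pi * I : ℂ) ≠ 0 := by simp [Real.pi_ne_zero]
  have : v + n * τ = k := by
    apply mul_left_cancel₀ h2; rw [hk]; ring
  have e := th_add_int_tau v τ n
  rw [this, th_int k hτ] at e
  rcases mul_eq_zero.mp e.symm with h | h
  · exact Complex.exp_ne_zero _ h
  · exact hv h

lemma th_eventually_shift {τ : ℂ} (hτ : 0 < τ.im) (c u₀ : ℂ) : ∀ᶠ u in 𝓝[≠] u₀, th (u + c) τ ≠ 0 := by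
  have h := th_eventually hτ (u₀ + c)
  have t : Filter.Tendsto (fun u => u + c) (𝓝[≠] u₀) (𝓝[≠] (u₀ + c)) := by
    refine tendsto_nhdsWithin_iff.mpr ⟨?_, ?_⟩
    · exact ((continuous_id.add continuous_const).tendsto u₀).mono_left nhdsWithin_le_nhds
    · filter_upwards [self_mem_nhdsWithin] with u hu
      simpa using hu
  exact t.eventually h

lemma roots_sum {N : ℕ} (hN : N ≠ 0) {ω y : ℂ} (hω : IsPrimitiveRoot ω N)
    (hy : ∀ k < N, ω ^ k * y ≠ 1) :
    ∑ k ∈ Finset.range N, (1 - ω ^ k * y)⁻¹ = N * (1 - y ^ N)⁻¹ := by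
  have hωN : ω ^ N = 1 := hω.pow_eq_one
  have hω0 : ω ≠ 0 := hω.ne_zero hN
  have hne : 1 - y ^ N ≠ 0 := by
    intro h
    have h1 : y⁻¹ ^ N = 1 := by
      rw [inv_pow, ← sub_eq_zero.mp h, inv_one]
    haveI : NeZero N := ⟨hN⟩
    obtain ⟨i, hi, e⟩ := hω.eq_pow_of_pow_eq_one h1
    apply hy i hi
    rw [e]
    apply inv_mul_cancel₀
    rintro rfl
    simp [hN] at h
  have e1 : ∀ k ∈ Finset.range N, (1 - ω ^ k * y)⁻¹ =
      (∑ j ∈ Finset.range N, (ω ^ k * y) ^ j) * (1 - y ^ N)⁻¹ := by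
    intro k hk
    have h0 : 1 - ω ^ k * y ≠ 0 := sub_ne_zero.mpr (hy k (Finset.mem_range.mp hk)).symm
    have g := geom_sum_mul_neg (ω ^ k * y) N
    have : (ω ^ k * y) ^ N = y ^ N := by
      rw [mul_pow, ← pow_mul, mul_comm k, pow_mul, hωN, one_pow, one_mul]
    rw [this] at g
    rw [← g] at hne ⊢
    rw [mul_inv, ← mul_assoc, mul_inv_cancel₀, one_mul]
    exact left_ne_zero_of_mul hne
  rw [Finset.sum_congr rfl e1, ← Finset.sum_mul]
  congr 1
  rw [Finset.sum_comm]
  have e2 : ∀ j ∈ Finset.range N, ∑ k ∈ Finset.range N, (ω ^ k * y) ^ j = if j = 0 then (N:ℂ) else 0 := by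
    intro j hj
    split_ifs with h
    · subst h; simp
    · have h1 : ω ^ j ≠ 1 := hω.pow_ne_one_of_pos_of_lt h (Finset.mem_range.mp hj)
      have g := geom_sum_mul_neg (ω ^ j) N
      rw [← pow_mul, mul_comm j, pow_mul, hωN, one_pow, sub_self] at g
      have g0 := (mul_eq_zero.mp g).resolve_right (sub_ne_zero.mpr h1.symm)
      simp only [mul_pow, ← pow_mul]
      rw [← Finset.sum_mul]
      simp only [mul_comm _ j, pow_mul]
      rw [g0, zero_mul]
  rw [Finset.sum_congr rfl e2, Finset.sum_ite_eq']
  simp [Nat.pos_of_ne_zero hN]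

lemma gk_sum {N : ℕ} (hN : N ≠ 0) {ζ τ : ℂ} (hg : ∀ k < N, Good τ ((ζ + k) / N)) (n : ℤ) :
    ∑ k ∈ Finset.range N, gk τ ((ζ + k) / N) n = N * gk (N * τ) ζ n := by
  have hNc : (N:ℂ) ≠ 0 := by exact_mod_cast hN
  have e : ∀ k : ℕ, cexp (2 * Real.pi * I * ((ζ + k) / N + n * τ)) =
      cexp (2 * Real.pi * I / N) ^ k * cexp (2 * Real.pi * I * (ζ / N + n * τ)) := by
    intro k
    rw [← Complex.exp_nat_mul, ← Complex.exp_add]; congr 1; field_simp; ring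
  have h := roots_sum hN (Complex.isPrimitiveRoot_exp N hN) (y := cexp (2 * Real.pi * I * (ζ / N + n * τ)))
    (fun k hk => by rw [← e]; exact hg k hk n)
  have e2 : cexp (2 * Real.pi * I * (ζ / N + n * τ)) ^ N = cexp (2 * Real.pi * I * (ζ + n * (N * τ))) := by
    rw [← Complex.exp_nat_mul]; congr 1; field_simp
  rw [e2] at h
  simp only [gk, e]
  exact h

lemma good_mul {N : ℕ} (hN : N ≠ 0) {ζ τ : ℂ} (hg : ∀ k < N, Good τ ((ζ + k) / N)) : Good (N * τ) ζ := by
  intro n h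
  have hNc : (N:ℂ) ≠ 0 := by exact_mod_cast hN
  have e2 : (cexp (-(2 * Real.pi * I * (ζ / N + n * τ)))) ^ N = 1 := by
    rw [← Complex.exp_nat_mul, mul_neg, Complex.exp_neg, inv_eq_one, ← h]; congr 1; field_simp
  haveI : NeZero N := ⟨hN⟩
  obtain ⟨i, hi, e⟩ := (Complex.isPrimitiveRoot_exp N hN).eq_pow_of_pow_eq_one e2
  apply hg i hi n
  have : cexp (2 * Real.pi * I * ((ζ + i) / N + n * τ)) =
      cexp (2 * Real.pi * I / N) ^ i * cexp (2 * Real.pi * I * (ζ / N + n * τ)) := by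
    rw [← Complex.exp_nat_mul, ← Complex.exp_add]; congr 1; field_simp; ring
  rw [this, e, ← Complex.exp_add]; simp

lemma im_N {N : ℕ} {τ : ℂ} : ((N:ℂ) * τ).im = N * τ.im := by simp

lemma imN_pos {N : ℕ} (hN : N ≠ 0) {τ : ℂ} (hτ : 0 < τ.im) : 0 < ((N:ℂ) * τ).im := by
  rw [im_N]
  have : (0:ℝ) < N := by exact_mod_cast Nat.pos_of_ne_zero hN
  positivity

lemma star_strip {N : ℕ} (hN : N ≠ 0) {ζ τ u : ℂ} (hτ : 0 < τ.im)
    (hz : ∀ k < N, th ((ζ + k) / N) τ ≠ 0) (hu : 0 < u.im) (hu2 : u.im < τ.im) :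
    Kc τ * (∑ k ∈ Finset.range N, th (u + (ζ + k) / N) τ / th ((ζ + k) / N) τ) *
      (th u (N * τ) * th ζ (N * τ)) = N * Kc (N * τ) * (th u τ * th (u + ζ) (N * τ)) := by
  have hg : ∀ k < N, Good τ ((ζ + k) / N) := fun k hk => good_of_ne hτ (hz k hk)
  have hg2 := good_mul hN hg
  have hT := imN_pos hN hτ
  have hu3 : u.im < ((N:ℂ) * τ).im := by
    rw [im_N]
    have : (1:ℝ) ≤ N := by exact_mod_cast Nat.one_le_iff_ne_zero.mpr hN
    nlinarith
  have k1 := kron hT hg2 hu hu3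
  have k2 : Kc τ * (∑ k ∈ Finset.range N, th (u + (ζ + k) / N) τ / th ((ζ + k) / N) τ) =
      th u τ * ∑ k ∈ Finset.range N, ∑' n : ℤ, cexp (2 * Real.pi * I * n * u) * gk τ ((ζ + k) / N) n := by
    rw [Finset.mul_sum, Finset.mul_sum]
    refine Finset.sum_congr rfl fun k hk => ?_
    have hk' := Finset.mem_range.mp hk
    rw [← mul_div_assoc, div_eq_iff (hz k hk'), ← kron hτ (hg k hk') hu hu2]
  have k3 : ∑ k ∈ Finset.range N, ∑' n : ℤ, cexp (2 * Real.pi * I * n * u) * gk τ ((ζ + k) / N) n =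
      N * ∑' n : ℤ, cexp (2 * Real.pi * I * n * u) * gk (N * τ) ζ n := by
    rw [← Summable.tsum_finsetSum, ← tsum_mul_left]
    · refine tsum_congr fun n => ?_
      rw [← Finset.mul_sum, gk_sum hN hg]; ring
    · intro k hk
      exact (fk_summable hτ (hg k (Finset.mem_range.mp hk)) hu hu2).of_norm
  rw [k2, k3]
  linear_combination (N * th u τ) * k1

lemma star {N : ℕ} (hN : N ≠ 0) {ζ τ : ℂ} (hτ : 0 < τ.im)
    (hz : ∀ k < N, th ((ζ + k) / N) τ ≠ 0) (u : ℂ) :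
    Kc τ * (∑ k ∈ Finset.range N, th (u + (ζ + k) / N) τ / th ((ζ + k) / N) τ) *
      (th u (N * τ) * th ζ (N * τ)) = N * Kc (N * τ) * (th u τ * th (u + ζ) (N * τ)) := by
  have d1 := th_differentiable hτ
  have d2 := th_differentiable (imN_pos hN hτ)
  have dd : ∀ c, Differentiable ℂ (fun u => th (u + c) τ) := fun c => d1.comp (differentiable_id.add_const c)
  have dd2 : ∀ c, Differentiable ℂ (fun u => th (u + c) (N * τ)) := fun c => d2.comp (differentiable_id.add_const c)
  have D1 : Differentiable ℂ (fun u => Kc τ * (∑ k ∈ Finset.range N, th (u + (ζ + k) / N) τ / th ((ζ + k) / N) τ) *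
      (th u (N * τ) * th ζ (N * τ))) := by
    refine Differentiable.mul (Differentiable.mul (differentiable_const _) ?_) (d2.mul_const _)
    refine Differentiable.fun_sum fun k _ => ?_
    exact (dd _).div_const _
  have D2 : Differentiable ℂ (fun u => N * Kc (N * τ) * (th u τ * th (u + ζ) (N * τ))) :=
    (d1.mul (dd2 ζ)).const_mul _
  have key := AnalyticOnNhd.eq_of_eventuallyEq (𝕜 := ℂ)
    (fun z _ => D1.analyticAt z) (fun z _ => D2.analyticAt z) (z₀ := τ / 2) ?_
  · exact congrFun key u
  · have c : Continuous fun z : ℂ => z.im := Complex.continuous_im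
    have him : (τ / 2).im = τ.im / 2 := by
      simp
    have o1 : ∀ᶠ z : ℂ in 𝓝 (τ / 2), 0 < z.im := c.continuousAt.eventually (lt_mem_nhds (by simp only [him]; linarith))
    have o2 : ∀ᶠ z : ℂ in 𝓝 (τ / 2), z.im < τ.im := c.continuousAt.eventually (gt_mem_nhds (by simp only [him]; linarith))
    filter_upwards [o1, o2] with z h1 h2 using star_strip hN hτ hz h1 h2

lemma theta_ne {N : ℕ} (hN : N ≠ 0) {ζ τ : ℂ} (hτ : 0 < τ.im)
    (hz : ∀ k < N, th ((ζ + k) / N) τ ≠ 0) : th ζ (N * τ) ≠ 0 := by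
  intro h
  have hT := imN_pos hN hτ
  have hNc : (N:ℂ) ≠ 0 := by exact_mod_cast hN
  obtain ⟨u, h1, h2⟩ := ((th_eventually hτ 0).and (th_eventually_shift hT ζ 0)).exists
  have := star hN hτ hz u
  rw [h, mul_zero, mul_zero] at this
  exact mul_ne_zero (mul_ne_zero hNc (Kc_ne_zero hT)) (mul_ne_zero h1 h2) this.symm
end

section

/-- normalized theta function of modulus `N τ` -/
def tt (N : ℕ) (τ : ℂ) (n : ℤ) (u : ℂ) : ℂ :=
  cexp (Real.pi * I * n ^ 2 * τ / N + 2 * Real.pi * I * n * u / N) * th (u + n * τ) (N * τ)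

lemma tt_neg (N : ℕ) (τ : ℂ) (n : ℤ) (u : ℂ) : tt N τ (-n) (-u) = - tt N τ n u := by
  rw [tt, tt]
  have : -u + (-n : ℤ) * τ = -(u + n * τ) := by push_cast; ring
  rw [this, th_neg, mul_neg]
  congr 3
  push_cast; ring

lemma tt_neg_zero (N : ℕ) (τ : ℂ) (n : ℤ) : tt N τ (-n) 0 = - tt N τ n 0 := by
  simpa using tt_neg N τ n 0

/-- the Weierstrass identity for `tt` -/
lemma tt_weier {N : ℕ} (hN : N ≠ 0) {τ : ℂ} (hτ : 0 < τ.im) (u ζ : ℂ) (i1 i2 j1 j2 a : ℤ) :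
    tt N τ (a + i1 - j1 - i2) u * tt N τ (a - j2) u * (tt N τ (j2 - i1) ζ * tt N τ (j1 - i2) ζ) -
    tt N τ (a + i1 - j2 - i2) u * tt N τ (a - j1) u * (tt N τ (j1 - i1) ζ * tt N τ (j2 - i2) ζ) =
    tt N τ (a + i1 - j1 - j2) (u - ζ) * tt N τ (j2 - j1) 0 * (tt N τ (a - i2) (u + ζ) * tt N τ (i1 - i2) 0) := by
  have hT := imN_pos hN hτ
  have hNc : (N:ℂ) ≠ 0 := by exact_mod_cast hN
  have w := weierstrass hT (u + (2 * a + i1 - j1 - j2 - i2) * τ / 2) ((i1 - i2 + j2 - j1) * τ / 2)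
    (ζ + (j1 + j2 - i1 - i2) * τ / 2) ((j2 - j1 + i2 - i1) * τ / 2)
  have hneg : th ((i1 - i2 + j2 - j1) * τ / 2 - (ζ + (j1 + j2 - i1 - i2) * τ / 2)) (N * τ) =
      - th (ζ + (j1 - i1 : ℤ) * τ) (N * τ) := by
    rw [← th_neg]; congr 1; push_cast; ring
  rw [hneg] at w
  have c1 : (u + (2 * a + i1 - j1 - j2 - i2) * τ / 2) + ((i1 - i2 + j2 - j1) * τ / 2) = u + (a + i1 - j1 - i2 : ℤ) * τ := by
    push_cast; ring
  have c2 : (u + (2 * a + i1 - j1 - j2 - i2) * τ / 2) - ((i1 - i2 + j2 - j1) * τ / 2) = u + (a - j2 : ℤ) * τ := by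
    push_cast; ring
  have c3 : (ζ + (j1 + j2 - i1 - i2) * τ / 2) + ((j2 - j1 + i2 - i1) * τ / 2) = ζ + (j2 - i1 : ℤ) * τ := by
    push_cast; ring
  have c4 : (ζ + (j1 + j2 - i1 - i2) * τ / 2) - ((j2 - j1 + i2 - i1) * τ / 2) = ζ + (j1 - i2 : ℤ) * τ := by
    push_cast; ring
  have c5 : (u + (2 * a + i1 - j1 - j2 - i2) * τ / 2) + (ζ + (j1 + j2 - i1 - i2) * τ / 2) = u + ζ + (a - i2 : ℤ) * τ := by
    push_cast; ring
  have c6 : (u + (2 * a + i1 - j1 - j2 - i2) * τ / 2) - (ζ + (j1 + j2 - i1 - i2) * τ / 2) = u - ζ + (a + i1 - j1 - j2 : ℤ) * τ := by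
    push_cast; ring
  have c7 : ((i1 - i2 + j2 - j1) * τ / 2) + ((j2 - j1 + i2 - i1) * τ / 2) = 0 + (j2 - j1 : ℤ) * τ := by
    push_cast; ring
  have c8 : ((i1 - i2 + j2 - j1) * τ / 2) - ((j2 - j1 + i2 - i1) * τ / 2) = 0 + (i1 - i2 : ℤ) * τ := by
    push_cast; ring
  have c9 : (u + (2 * a + i1 - j1 - j2 - i2) * τ / 2) + ((j2 - j1 + i2 - i1) * τ / 2) = u + (a - j1 : ℤ) * τ := by
    push_cast; ring
  have c10 : (u + (2 * a + i1 - j1 - j2 - i2) * τ / 2) - ((j2 - j1 + i2 - i1) * τ / 2) = u + (a + i1 - j2 - i2 : ℤ) * τ := by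
    push_cast; ring
  have c11 : ((i1 - i2 + j2 - j1) * τ / 2) + (ζ + (j1 + j2 - i1 - i2) * τ / 2) = ζ + (j2 - i2 : ℤ) * τ := by
    push_cast; ring
  rw [c1, c2, c3, c4, c5, c6, c7, c8, c9, c10, c11] at w
  have four : ∀ (n1 n2 n3 n4 : ℤ) (x1 x2 x3 x4 : ℂ), tt N τ n1 x1 * tt N τ n2 x2 * (tt N τ n3 x3 * tt N τ n4 x4) =
      cexp (Real.pi * I / N * ((n1^2 + n2^2 + n3^2 + n4^2 : ℤ) * τ + 2 * (n1 * x1 + n2 * x2 + n3 * x3 + n4 * x4))) *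
      (th (x1 + n1 * τ) (N * τ) * th (x2 + n2 * τ) (N * τ) * (th (x3 + n3 * τ) (N * τ) * th (x4 + n4 * τ) (N * τ))) := by
    intro n1 n2 n3 n4 x1 x2 x3 x4
    simp only [tt]
    have : cexp (Real.pi * I / N * ((n1^2 + n2^2 + n3^2 + n4^2 : ℤ) * τ + 2 * (n1 * x1 + n2 * x2 + n3 * x3 + n4 * x4))) =
        cexp (Real.pi * I * n1 ^ 2 * τ / N + 2 * Real.pi * I * n1 * x1 / N) * cexp (Real.pi * I * n2 ^ 2 * τ / N + 2 * Real.pi * I * n2 * x2 / N) *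
        (cexp (Real.pi * I * n3 ^ 2 * τ / N + 2 * Real.pi * I * n3 * x3 / N) * cexp (Real.pi * I * n4 ^ 2 * τ / N + 2 * Real.pi * I * n4 * x4 / N)) := by
      rw [← Complex.exp_add, ← Complex.exp_add, ← Complex.exp_add]; congr 1; push_cast; field_simp; ring
    rw [this]; ring
  rw [four, four, four]
  set E := cexp (Real.pi * I / N * (((a + i1 - j1 - i2)^2 + (a - j2)^2 + (j2 - i1)^2 + (j1 - i2)^2 : ℤ) * τ +
    2 * ((a + i1 - j1 - i2 : ℤ) * u + (a - j2 : ℤ) * u + (j2 - i1 : ℤ) * ζ + (j1 - i2 : ℤ) * ζ))) with hE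
  have E2 : cexp (Real.pi * I / N * (((a + i1 - j2 - i2)^2 + (a - j1)^2 + (j1 - i1)^2 + (j2 - i2)^2 : ℤ) * τ +
    2 * ((a + i1 - j2 - i2 : ℤ) * u + (a - j1 : ℤ) * u + (j1 - i1 : ℤ) * ζ + (j2 - i2 : ℤ) * ζ))) = E := by
    rw [hE]; congr 2; push_cast; ring
  have E3 : cexp (Real.pi * I / N * (((a + i1 - j1 - j2)^2 + (j2 - j1)^2 + (a - i2)^2 + (i1 - i2)^2 : ℤ) * τ +
    2 * ((a + i1 - j1 - j2 : ℤ) * (u - ζ) + (j2 - j1 : ℤ) * 0 + (a - i2 : ℤ) * (u + ζ) + (i1 - i2 : ℤ) * 0))) = E := by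
    rw [hE]; congr 2; push_cast; ring
  rw [E2, E3]
  linear_combination E * w

/-- matrix entries of the Belavin matrix -/
def ME (N : ℕ) (ζ τ u : ℂ) (m n : ℤ) : ℂ :=
  ∑ k ∈ Finset.range N, cexp (-(2 * Real.pi * I * m * k / N)) * (cexp (2 * Real.pi * I * n * u / N) *
    th (u + (ζ + n * τ + k) / N) τ / th ((ζ + n * τ + k) / N) τ)

/-- all the needed theta values are nonzero -/
def HZ (N : ℕ) (ζ τ : ℂ) : Prop := ∀ (n : ℤ), ∀ k < N, th ((ζ + n * τ + (k:ℕ)) / N) τ ≠ 0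

lemma ME_entry {N : ℕ} (hN : N ≠ 0) {ζ τ : ℂ} (hτ : 0 < τ.im) (hz : HZ N ζ τ) (u : ℂ) (m n : ℤ) :
    Kc τ * ME N ζ τ u m n * (tt N τ m u * tt N τ n ζ) =
      N * Kc (N * τ) * (th u τ * tt N τ (m + n) (u + ζ)) := by
  have hNc : (N:ℂ) ≠ 0 := by exact_mod_cast hN
  have s := star hN hτ (hz n) (u + m * τ)
  have e1 : ∀ k : ℕ, th (u + m * τ + (ζ + n * τ + k) / N) τ =
      cexp (-(Real.pi * I * m^2 * τ) - 2 * Real.pi * I * m * (u + 1/2)) * cexp (-(2 * Real.pi * I * m * (ζ + n * τ) / N)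
        - 2 * Real.pi * I * n * u / N) *
      (cexp (-(2 * Real.pi * I * m * k / N)) * (cexp (2 * Real.pi * I * n * u / N) * th (u + (ζ + n * τ + k) / N) τ)) := by
    intro k
    have : u + m * τ + (ζ + n * τ + k) / N = (u + (ζ + n * τ + k) / N) + m * τ := by ring
    rw [this, th_add_int_tau]
    rw [← mul_assoc, ← mul_assoc, ← Complex.exp_add, ← Complex.exp_add, ← Complex.exp_add]
    congr 2
    field_simp
    ring
  have e2 : ∑ k ∈ Finset.range N, th (u + m * τ + (ζ + n * τ + k) / N) τ / th ((ζ + n * τ + k) / N) τ =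
      cexp (-(Real.pi * I * m^2 * τ) - 2 * Real.pi * I * m * (u + 1/2)) * cexp (-(2 * Real.pi * I * m * (ζ + n * τ) / N)
        - 2 * Real.pi * I * n * u / N) * ME N ζ τ u m n := by
    rw [ME, Finset.mul_sum]
    refine Finset.sum_congr rfl fun k _ => ?_
    rw [e1]; ring
  rw [e2, th_add_int_tau u τ m] at s
  have e3 : u + m * τ + (ζ + n * τ) = u + ζ + (m + n : ℤ) * τ := by push_cast; ring
  rw [e3] at s
  have e4 : cexp (Real.pi * I * (m + n : ℤ) ^ 2 * τ / N + 2 * Real.pi * I * (m + n : ℤ) * (u + ζ) / N) *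
      cexp (-(2 * Real.pi * I * m * (ζ + n * τ) / N) - 2 * Real.pi * I * n * u / N) =
      cexp (Real.pi * I * m ^ 2 * τ / N + 2 * Real.pi * I * m * u / N) *
      cexp (Real.pi * I * n ^ 2 * τ / N + 2 * Real.pi * I * n * ζ / N) := by
    rw [← Complex.exp_add, ← Complex.exp_add]; congr 1; push_cast; field_simp; ring
  have hX := Complex.exp_ne_zero (-(Real.pi * I * m^2 * τ) - 2 * Real.pi * I * m * (u + 1/2))
  apply mul_left_cancel₀ hX
  simp only [tt]
  linear_combination cexp (Real.pi * I * (m + n : ℤ) ^ 2 * τ / N + 2 * Real.pi * I * (m + n : ℤ) * (u + ζ) / N) * s -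
    Kc τ * cexp (-(Real.pi * I * m^2 * τ) - 2 * Real.pi * I * m * (u + 1/2)) * ME N ζ τ u m n * th (u + m * τ) (N * τ) *
     th (ζ + n * τ) (N * τ) * e4

lemma tt_ne {N : ℕ} (hN : N ≠ 0) {ζ τ : ℂ} (hτ : 0 < τ.im) (hz : HZ N ζ τ) (n : ℤ) : tt N τ n ζ ≠ 0 :=
  mul_ne_zero (Complex.exp_ne_zero _) (theta_ne hN hτ (hz n))

lemma tt_eventually {N : ℕ} (hN : N ≠ 0) {τ : ℂ} (hτ : 0 < τ.im) (n : ℤ) (c u₀ : ℂ) :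
    ∀ᶠ u in 𝓝[≠] u₀, tt N τ n (u - c) ≠ 0 := by
  filter_upwards [th_eventually_shift (imN_pos hN hτ) (n * τ - c) u₀] with u hu
  refine mul_ne_zero (Complex.exp_ne_zero _) ?_
  convert hu using 2; ring

lemma ME_continuous {N : ℕ} {ζ τ : ℂ} (hτ : 0 < τ.im) (m n : ℤ) :
    Continuous fun u => ME N ζ τ u m n := by
  unfold ME
  refine continuous_finset_sum _ fun k _ => ?_
  have : Continuous fun u => th (u + (ζ + n * τ + k) / N) τ :=
    (th_differentiable hτ).continuous.comp (continuous_id.add continuous_const)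
  exact continuous_const.mul ((Continuous.mul (by fun_prop) this).div_const _)

lemma ME_four_gen {N : ℕ} (hN : N ≠ 0) {ζ τ : ℂ} (hτ : 0 < τ.im) (hz : HZ N ζ τ) (u : ℂ) (i1 i2 j1 j2 a : ℤ)
    (h1 : tt N τ (a - j1) u ≠ 0) (h2 : tt N τ (a - j2) u ≠ 0)
    (h3 : tt N τ (a + i1 - j1 - j2) (u - ζ) ≠ 0) (h4 : tt N τ (a + i2 - j1 - j2) (u - ζ) ≠ 0) :
    ME N ζ τ u (a - j1) (j1 - i1) * ME N ζ τ (u - ζ) (a + i1 - j1 - j2) (j2 - i2) +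
    ME N ζ τ u (a - j1) (j1 - i2) * ME N ζ τ (u - ζ) (a + i2 - j1 - j2) (j2 - i1) =
    ME N ζ τ u (a - j2) (j2 - i1) * ME N ζ τ (u - ζ) (a + i1 - j1 - j2) (j1 - i2) +
    ME N ζ τ u (a - j2) (j2 - i2) * ME N ζ τ (u - ζ) (a + i2 - j1 - j2) (j1 - i1) := by
  have hK := Kc_ne_zero hτ
  set c := N * Kc (N * τ) / Kc τ with hc
  have f : ∀ (u : ℂ) (m n p : ℤ), tt N τ m u ≠ 0 → m + n = p → ME N ζ τ u m n =
      c * (th u τ * tt N τ p (u + ζ)) / (tt N τ m u * tt N τ n ζ) := by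
    rintro u m n p h rfl
    rw [eq_div_iff (mul_ne_zero h (tt_ne hN hτ hz n)), hc, div_mul_eq_mul_div, eq_div_iff hK,
      ← ME_entry hN hτ hz]
    ring
  rw [f u (a - j1) (j1 - i1) (a - i1) h1 (by ring), f u (a - j1) (j1 - i2) (a - i2) h1 (by ring),
    f u (a - j2) (j2 - i1) (a - i1) h2 (by ring), f u (a - j2) (j2 - i2) (a - i2) h2 (by ring),
    f (u - ζ) (a + i1 - j1 - j2) (j2 - i2) (a + i1 - j1 - i2) h3 (by ring),
    f (u - ζ) (a + i2 - j1 - j2) (j2 - i1) (a + i2 - j1 - i1) h4 (by ring),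
    f (u - ζ) (a + i1 - j1 - j2) (j1 - i2) (a + i1 - j2 - i2) h3 (by ring),
    f (u - ζ) (a + i2 - j1 - j2) (j1 - i1) (a + i2 - j2 - i1) h4 (by ring)]
  rw [sub_add_cancel]
  have w1 := tt_weier hN hτ u ζ i1 i2 j1 j2 a
  have w2 := tt_weier hN hτ u ζ i2 i1 j1 j2 a
  have sw : tt N τ (i2 - i1) 0 = - tt N τ (i1 - i2) 0 := by
    rw [← tt_neg_zero]; congr 1; ring
  rw [sw] at w2
  have n1 := tt_ne hN hτ hz (j1 - i1)
  have n2 := tt_ne hN hτ hz (j1 - i2)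
  have n3 := tt_ne hN hτ hz (j2 - i1)
  have n4 := tt_ne hN hτ hz (j2 - i2)
  generalize tt N τ (j1 - i1) ζ = z11 at *
  generalize tt N τ (j1 - i2) ζ = z12 at *
  generalize tt N τ (j2 - i1) ζ = z21 at *
  generalize tt N τ (j2 - i2) ζ = z22 at *
  generalize tt N τ (a - j1) u = p1 at *
  generalize tt N τ (a - j2) u = p2 at *
  generalize tt N τ (a + i1 - j1 - j2) (u - ζ) = r1 at *
  generalize tt N τ (a + i2 - j1 - j2) (u - ζ) = r2 at *
  generalize tt N τ (a - i1) (u + ζ) = s1 at *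
  generalize tt N τ (a - i2) (u + ζ) = s2 at *
  generalize tt N τ (a + i1 - j1 - i2) u = x1 at *
  generalize tt N τ (a + i1 - j2 - i2) u = x2 at *
  generalize tt N τ (a + i2 - j1 - i1) u = y1 at *
  generalize tt N τ (a + i2 - j2 - i1) u = y2 at *
  generalize tt N τ (j2 - j1) 0 = d at *
  generalize tt N τ (i1 - i2) 0 = e at *
  generalize th u τ = t1
  generalize th (u - ζ) τ = t2
  have g1 : x1 * p2 * (z21 * z12) * s1 * r2 - x2 * p1 * (z11 * z22) * s1 * r2 = r1 * r2 * s1 * s2 * d * e := by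
    linear_combination s1 * r2 * w1
  have g2 : y1 * p2 * (z22 * z11) * s2 * r1 - y2 * p1 * (z12 * z21) * s2 * r1 = - (r1 * r2 * s1 * s2 * d * e) := by
    linear_combination s2 * r1 * w2
  clear_value c
  field_simp
  linear_combination c ^ 2 * t1 * t2 * (g1 + g2)

lemma ME_four {N : ℕ} (hN : N ≠ 0) {ζ τ : ℂ} (hτ : 0 < τ.im) (hz : HZ N ζ τ) (u : ℂ) (i1 i2 j1 j2 a : ℤ) :
    ME N ζ τ u (a - j1) (j1 - i1) * ME N ζ τ (u - ζ) (a + i1 - j1 - j2) (j2 - i2) +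
    ME N ζ τ u (a - j1) (j1 - i2) * ME N ζ τ (u - ζ) (a + i2 - j1 - j2) (j2 - i1) =
    ME N ζ τ u (a - j2) (j2 - i1) * ME N ζ τ (u - ζ) (a + i1 - j1 - j2) (j1 - i2) +
    ME N ζ τ u (a - j2) (j2 - i2) * ME N ζ τ (u - ζ) (a + i2 - j1 - j2) (j1 - i1) := by
  have C : ∀ m n, Continuous fun u => ME N ζ τ u m n := ME_continuous hτ
  have C' : ∀ m n, Continuous fun u => ME N ζ τ (u - ζ) m n := fun m n =>
    (C m n).comp (continuous_id.sub continuous_const)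
  have cL := (((C (a - j1) (j1 - i1)).mul (C' (a + i1 - j1 - j2) (j2 - i2))).add
    ((C (a - j1) (j1 - i2)).mul (C' (a + i2 - j1 - j2) (j2 - i1)))).tendsto u
  have cR := (((C (a - j2) (j2 - i1)).mul (C' (a + i1 - j1 - j2) (j1 - i2))).add
    ((C (a - j2) (j2 - i2)).mul (C' (a + i2 - j1 - j2) (j1 - i1)))).tendsto u
  refine tendsto_nhds_unique_of_eventuallyEq (cL.mono_left (nhdsWithin_le_nhds (s := {u}ᶜ)))
    (cR.mono_left nhdsWithin_le_nhds) ?_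
  have b1 := tt_eventually hN hτ (a - j1) 0 u
  have b2 := tt_eventually hN hτ (a - j2) 0 u
  have b3 := tt_eventually hN hτ (a + i1 - j1 - j2) ζ u
  have b4 := tt_eventually hN hτ (a + i2 - j1 - j2) ζ u
  filter_upwards [b1, b2, b3, b4] with v h1 h2 h3 h4
  rw [sub_zero] at h1 h2
  exact ME_four_gen hN hτ hz v i1 i2 j1 j2 a h1 h2 h3 h4
end

section

lemma dv {a b c : ℤ} (h : a ∣ b) (e : c = b) : a ∣ c := e ▸ h

lemma fin_eq_of_dvd {N : ℕ} {x y : Fin N} (h : (N:ℤ) ∣ ((x:ℕ):ℤ) - ((y:ℕ):ℤ)) : x = y := by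
  have hx := x.2
  have hy := y.2
  have := Int.eq_zero_of_abs_lt_dvd h (by rw [abs_lt]; constructor <;> omega)
  ext; omega

lemma fin_exists {N : ℕ} (hN : N ≠ 0) (t : ℤ) : ∃ x : Fin N, (N:ℤ) ∣ ((x:ℕ):ℤ) - t := by
  have hp : (0:ℤ) < N := by exact_mod_cast Nat.pos_of_ne_zero hN
  have h0 := Int.emod_nonneg t hp.ne'
  have h1 := Int.emod_lt_of_pos t hp
  refine ⟨⟨(t % N).toNat, by omega⟩, ?_⟩
  simp only [Int.toNat_of_nonneg h0]
  exact ⟨-(t / N), by have := Int.emod_add_mul_ediv t N; linarith⟩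

lemma nat_mod_iff {N : ℕ} (x : Fin N) (t : ℕ) : (x:ℕ) = t % N ↔ (N:ℤ) ∣ ((x:ℕ):ℤ) - (t:ℤ) := by
  have hN : 0 < N := x.pos
  constructor
  · intro h
    rw [h]
    push_cast
    exact ⟨-((t:ℤ) / N), by have := Int.emod_add_mul_ediv (t:ℤ) N; linarith⟩
  · intro h
    have : x = ⟨t % N, Nat.mod_lt _ hN⟩ := by
      apply fin_eq_of_dvd
      have h2 : (N:ℤ) ∣ (t:ℤ) - ((t % N : ℕ) : ℤ) := by
        push_cast
        exact ⟨((t:ℤ) / N), by have := Int.emod_add_mul_ediv (t:ℤ) N; linarith⟩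
      have := dvd_add h h2
      simpa using this
    rw [this]

lemma hMat_pow (N m : ℕ) (j l : Fin N) :
    (hMat N ^ m) j l = if (N:ℤ) ∣ ((l:ℕ):ℤ) - ((j:ℕ):ℤ) - m then 1 else 0 := by
  have hN : N ≠ 0 := by have := j.pos; omega
  induction m generalizing l with
  | zero =>
    rw [pow_zero, Matrix.one_apply]
    by_cases h : j = l
    · subst h; simp
    · rw [if_neg h, if_neg]
      intro hd
      apply h
      symm
      apply fin_eq_of_dvd
      simpa using hd
  | succ m ih =>
    rw [pow_succ, Matrix.mul_apply]
    obtain ⟨x, hx⟩ := fin_exists hN (((j:ℕ):ℤ) + m)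
    rw [Finset.sum_eq_single x]
    · rw [ih, if_pos (by exact dv hx (by ring)), one_mul]
      simp only [hMat, Matrix.of_apply, nat_mod_iff]
      congr 1
      rw [eq_iff_iff]
      push_cast
      constructor
      · intro h; have := dvd_add h hx; exact dv this (by ring)
      · intro h; have := dvd_sub h hx; exact dv this (by ring)
    · intro y _ hy
      rw [ih, if_neg, zero_mul]
      intro hd
      apply hy
      apply fin_eq_of_dvd
      have := dvd_sub hd hx
      exact dv this (by ring)
    · simp

/-- the diagonal entries of `g` -/
def gd (N : ℕ) (j : Fin N) : ℂ := eπ (2 * (((j : ℕ) : ℂ) + 1) / N)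

lemma gd_ne (N : ℕ) (j : Fin N) : gd N j ≠ 0 := Complex.exp_ne_zero _

lemma Imat_apply (N : ℕ) (α : Fin N × Fin N) (i j : Fin N) :
    Imat N α i j = if (N:ℤ) ∣ ((j:ℕ):ℤ) - ((i:ℕ):ℤ) - ((α.1:ℕ):ℤ) then gd N i ^ (α.2:ℕ) else 0 := by
  rw [Imat, gMat, Matrix.diagonal_pow, Matrix.diagonal_mul, hMat_pow]
  simp [gd]

lemma Imat_inv_apply (N : ℕ) (α : Fin N × Fin N) (a b : Fin N) :
    (Imat N α)⁻¹ a b = if (N:ℤ) ∣ ((a:ℕ):ℤ) - ((b:ℕ):ℤ) - ((α.1:ℕ):ℤ) then (gd N b ^ (α.2:ℕ))⁻¹ else 0 := by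
  have hN : N ≠ 0 := by have := a.pos; omega
  have : (Imat N α)⁻¹ = Matrix.of fun a b : Fin N =>
      if (N:ℤ) ∣ ((a:ℕ):ℤ) - ((b:ℕ):ℤ) - ((α.1:ℕ):ℤ) then (gd N b ^ (α.2:ℕ))⁻¹ else 0 := by
    apply Matrix.inv_eq_right_inv
    ext i k
    rw [Matrix.mul_apply]
    obtain ⟨x, hx⟩ := fin_exists hN (((i:ℕ):ℤ) + ((α.1:ℕ):ℤ))
    rw [Finset.sum_eq_single x]
    · rw [Imat_apply, if_pos (by exact dv hx (by ring)), Matrix.of_apply, Matrix.one_apply]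
      by_cases h : i = k
      · subst h
        rw [if_pos (by exact dv hx (by ring)), if_pos rfl]
        exact mul_inv_cancel₀ (pow_ne_zero _ (gd_ne _ _))
      · rw [if_neg h, if_neg, mul_zero]
        intro hd
        apply h
        apply fin_eq_of_dvd
        have := dvd_sub hd hx
        exact dv this (by ring)
    · intro y _ hy
      rw [Imat_apply, if_neg, zero_mul]
      intro hd
      apply hy
      apply fin_eq_of_dvd
      have := dvd_sub hd hx
      exact dv this (by ring)
    · simp
  rw [this, Matrix.of_apply]

lemma ME_period_n {N : ℕ} (hN : N ≠ 0) (ζ τ u : ℂ) (m n c : ℤ) :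
    ME N ζ τ u m (n + N * c) = ME N ζ τ u m n := by
  have hNc : (N:ℂ) ≠ 0 := by exact_mod_cast hN
  unfold ME
  refine Finset.sum_congr rfl fun k _ => ?_
  congr 1
  have e1 : (ζ + (n + N * c : ℤ) * τ + k) / N = (ζ + n * τ + k) / N + c * τ := by
    push_cast; field_simp; ring
  have e2 : u + (ζ + (n + N * c : ℤ) * τ + k) / N = u + (ζ + n * τ + k) / N + c * τ := by
    rw [e1]; ring
  rw [e2, e1, th_add_int_tau, th_add_int_tau]
  have e3 : cexp (2 * Real.pi * I * (n + N * c : ℤ) * u / N) *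
      cexp (-(Real.pi * I * c ^ 2 * τ) - 2 * Real.pi * I * c * (u + (ζ + n * τ + k) / N + 1 / 2)) =
      cexp (2 * Real.pi * I * n * u / N) *
      cexp (-(Real.pi * I * c ^ 2 * τ) - 2 * Real.pi * I * c * ((ζ + n * τ + k) / N + 1 / 2)) := by
    rw [← Complex.exp_add, ← Complex.exp_add]; congr 1; push_cast; field_simp; ring
  rw [← mul_assoc, e3, mul_right_comm, mul_comm (cexp (-(Real.pi * I * c ^ 2 * τ) - 2 * Real.pi * I * c * ((ζ + n * τ + k) / N + 1 / 2)))]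
  exact mul_div_mul_right _ _ (Complex.exp_ne_zero _)

lemma ME_period_m {N : ℕ} (hN : N ≠ 0) (ζ τ u : ℂ) (m n c : ℤ) :
    ME N ζ τ u (m + N * c) n = ME N ζ τ u m n := by
  have hNc : (N:ℂ) ≠ 0 := by exact_mod_cast hN
  unfold ME
  refine Finset.sum_congr rfl fun k _ => ?_
  congr 1
  have : -(2 * Real.pi * I * (m + N * c : ℤ) * k / N) = -(2 * Real.pi * I * m * k / N) + (-(c * k) : ℤ) * (2 * Real.pi * I) := by
    push_cast; field_simp; ring
  rw [this, Complex.exp_add, Complex.exp_int_mul_two_pi_mul_I, mul_one]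

lemma ME_congr {N : ℕ} (hN : N ≠ 0) (ζ τ u : ℂ) {m n m' n' : ℤ} (hm : (N:ℤ) ∣ m' - m) (hn : (N:ℤ) ∣ n' - n) :
    ME N ζ τ u m' n' = ME N ζ τ u m n := by
  obtain ⟨c, hc⟩ := hm
  obtain ⟨d, hd⟩ := hn
  have e1 : m' = m + N * c := by linarith
  have e2 : n' = n + N * d := by linarith
  rw [e1, e2, ME_period_m hN, ME_period_n hN]

/-- the matrix inside `Zmat` -/
def Lm (N : ℕ) (ξ ζ τ : ℂ) : Matrix (Fin N × Fin N) (Fin N × Fin N) ℂ :=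
  ∑ α : Fin N × Fin N, Wcoef N α ξ ζ τ • (Imat N α ⊗ₖ (Imat N α)⁻¹)

lemma Lm_apply {N : ℕ} (hN : N ≠ 0) (ξ ζ τ : ℂ) (i a j b : Fin N) :
    Lm N ξ ζ τ (i, a) (j, b) = if (N:ℤ) ∣ (((i:ℕ):ℤ) + ((a:ℕ):ℤ) - ((j:ℕ):ℤ) - ((b:ℕ):ℤ)) then
      (N:ℂ)⁻¹ * ME N ζ τ ξ (((a:ℕ):ℤ) - ((j:ℕ):ℤ)) (((j:ℕ):ℤ) - ((i:ℕ):ℤ)) else 0 := by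
  have hNc : (N:ℂ) ≠ 0 := by exact_mod_cast hN
  rw [Lm, Matrix.sum_apply]
  simp only [Matrix.smul_apply, Matrix.kroneckerMap_apply, smul_eq_mul, Imat_apply, Imat_inv_apply]
  rw [Fintype.sum_prod_type]
  obtain ⟨n, hn⟩ := fin_exists hN (((j:ℕ):ℤ) - ((i:ℕ):ℤ))
  rw [Finset.sum_eq_single n]
  · simp only
    have hp : (N:ℤ) ∣ ((j:ℕ):ℤ) - ((i:ℕ):ℤ) - ((n:ℕ):ℤ) := by rw [← dvd_neg]; exact dv hn (by ring)
    simp only [if_pos hp]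
    split_ifs with h1 h2 h2
    · rw [← ME_congr hN ζ τ ξ (m := ((a:ℕ):ℤ) - ((j:ℕ):ℤ)) (m' := ((b:ℕ):ℤ) - ((i:ℕ):ℤ)) (n' := ((n:ℕ):ℤ)) ?_ hn]
      · rw [ME, Finset.mul_sum, Finset.sum_range]
        refine Finset.sum_congr rfl fun k _ => ?_
        have e0 : gd N i ^ (k:ℕ) * (gd N b ^ (k:ℕ))⁻¹ =
            cexp (-(2 * Real.pi * I * (((b:ℕ):ℤ) - ((i:ℕ):ℤ) : ℤ) * (k:ℕ) / N)) := by
          rw [gd, gd, eπ, eπ, ← Complex.exp_nat_mul, ← Complex.exp_nat_mul, ← Complex.exp_neg, ← Complex.exp_add]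
          congr 1
          push_cast; field_simp; ring
        rw [e0, Wcoef]
        have J := fun w => jTheta_char (((n:ℕ):ℝ) / N) (((k:ℕ):ℝ) / N) w τ
        rw [J, J]
        have a1 : ζ / N + ((((n:ℕ):ℝ) / N : ℝ):ℂ) * τ + ((((k:ℕ):ℝ) / N : ℝ):ℂ) = (ζ + ((n:ℕ):ℤ) * τ + (k:ℕ)) / N := by
          push_cast; field_simp
        have a2 : ξ + ζ / N + ((((n:ℕ):ℝ) / N : ℝ):ℂ) * τ + ((((k:ℕ):ℝ) / N : ℝ):ℂ) = ξ + (ζ + ((n:ℕ):ℤ) * τ + (k:ℕ)) / N := by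
          push_cast; field_simp; ring
        rw [a1, a2]
        have a3 : cexp (Real.pi * I * ((((n:ℕ):ℝ) / N : ℝ):ℂ) ^ 2 * τ + 2 * Real.pi * I * ((((n:ℕ):ℝ) / N : ℝ):ℂ) * (ξ + ζ / N + 1 / 2 + ((((k:ℕ):ℝ) / N : ℝ):ℂ))) =
           cexp (2 * Real.pi * I * ((n:ℕ):ℤ) * ξ / N) *
           cexp (Real.pi * I * ((((n:ℕ):ℝ) / N : ℝ):ℂ) ^ 2 * τ + 2 * Real.pi * I * ((((n:ℕ):ℝ) / N : ℝ):ℂ) * (ζ / N + 1 / 2 + ((((k:ℕ):ℝ) / N : ℝ):ℂ))) := by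
          rw [← Complex.exp_add]; congr 1; push_cast; field_simp; ring
        rw [a3]
        generalize th (ξ + (ζ + ((n:ℕ):ℤ) * τ + (k:ℕ)) / N) τ = A
        generalize th ((ζ + ((n:ℕ):ℤ) * τ + (k:ℕ)) / N) τ = B
        have hE := Complex.exp_ne_zero (Real.pi * I * ((((n:ℕ):ℝ) / N : ℝ):ℂ) ^ 2 * τ + 2 * Real.pi * I * ((((n:ℕ):ℝ) / N : ℝ):ℂ) * (ζ / N + 1 / 2 + ((((k:ℕ):ℝ) / N : ℝ):ℂ)))
        generalize cexp (Real.pi * I * ((((n:ℕ):ℝ) / N : ℝ):ℂ) ^ 2 * τ + 2 * Real.pi * I * ((((n:ℕ):ℝ) / N : ℝ):ℂ) * (ζ / N + 1 / 2 + ((((k:ℕ):ℝ) / N : ℝ):ℂ))) = E at *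
        generalize cexp (2 * Real.pi * I * ((n:ℕ):ℤ) * ξ / N) = X
        have : X * E * A / (N * (E * B)) = (N:ℂ)⁻¹ * (X * A / B) := by
          rw [show X * E * A = E * (X * A) by ring, show N * (E * B) = E * (N * B) by ring, mul_div_mul_left _ _ hE, div_mul_eq_div_div]
          ring
        rw [this]; ring
      · rw [← dvd_neg]; exact dv h2 (by ring)
    · exfalso; apply h2
      have := dvd_add h1 hn
      exact dv this (by ring)
    · exfalso; apply h1
      have := dvd_sub h2 hn
      exact dv this (by ring)
    · simp
  · intro m _ hm
    refine Finset.sum_eq_zero fun k _ => ?_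
    simp only
    rw [if_neg, zero_mul, mul_zero]
    intro hd
    apply hm
    apply fin_eq_of_dvd
    have := dvd_add hd hn
    rw [← dvd_neg]
    have := dvd_add hd hn
    exact dv this (by ring)
  · simp

lemma Lm_sum {N : ℕ} (hN : N ≠ 0) (ξ ξ' ζ τ : ℂ) (i1 i2 j1 j2 a c : Fin N) :
    ∑ x, Lm N ξ ζ τ (i1, a) (j1, x) * Lm N ξ' ζ τ (i2, x) (j2, c) =
    if (N:ℤ) ∣ (((i1:ℕ):ℤ) + ((i2:ℕ):ℤ) + ((a:ℕ):ℤ) - ((j1:ℕ):ℤ) - ((j2:ℕ):ℤ) - ((c:ℕ):ℤ)) then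
      (N:ℂ)⁻¹ ^ 2 * (ME N ζ τ ξ (((a:ℕ):ℤ) - ((j1:ℕ):ℤ)) (((j1:ℕ):ℤ) - ((i1:ℕ):ℤ)) *
        ME N ζ τ ξ' (((a:ℕ):ℤ) + ((i1:ℕ):ℤ) - ((j1:ℕ):ℤ) - ((j2:ℕ):ℤ)) (((j2:ℕ):ℤ) - ((i2:ℕ):ℤ))) else 0 := by
  obtain ⟨x, hx⟩ := fin_exists hN (((i1:ℕ):ℤ) + ((a:ℕ):ℤ) - ((j1:ℕ):ℤ))
  rw [Finset.sum_eq_single x]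
  · rw [Lm_apply hN, Lm_apply hN, if_pos (by rw [← dvd_neg]; exact dv hx (by ring))]
    rw [ME_congr hN ζ τ ξ' (m := ((a:ℕ):ℤ) + ((i1:ℕ):ℤ) - ((j1:ℕ):ℤ) - ((j2:ℕ):ℤ)) (m' := ((x:ℕ):ℤ) - ((j2:ℕ):ℤ))
      (n := ((j2:ℕ):ℤ) - ((i2:ℕ):ℤ)) (by exact dv hx (by ring)) (by simp)]
    split_ifs with h1 h2 h2
    · ring
    · exfalso; apply h2
      have := dvd_sub h1 hx
      exact dv this (by ring)
    · exfalso; apply h1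
      have := dvd_add h2 hx
      exact dv this (by ring)
    · simp
  · intro y _ hy
    rw [Lm_apply hN, if_neg, zero_mul]
    intro hd
    apply hy
    apply fin_eq_of_dvd
    rw [← dvd_neg]
    have := dvd_add hd hx
    exact dv this (by ring)
  · simp

lemma Lm_fourTerm {N : ℕ} (hN : N ≠ 0) {ζ τ : ℂ} (hτ : 0 < τ.im) (hz : HZ N ζ τ) (u : ℂ) :
    FourTerm (Lm N u ζ τ) (Lm N (u - ζ) ζ τ) := by
  intro i1 i2 j1 j2 a c
  rw [Lm_sum hN, Lm_sum hN, Lm_sum hN, Lm_sum hN]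
  have f := ME_four hN hτ hz u i1 i2 j1 j2 a
  have c2 : (((i2:ℕ):ℤ) + ((i1:ℕ):ℤ) + ((a:ℕ):ℤ) - ((j1:ℕ):ℤ) - ((j2:ℕ):ℤ) - ((c:ℕ):ℤ)) =
    (((i1:ℕ):ℤ) + ((i2:ℕ):ℤ) + ((a:ℕ):ℤ) - ((j1:ℕ):ℤ) - ((j2:ℕ):ℤ) - ((c:ℕ):ℤ)) := by ring
  have c3 : (((i1:ℕ):ℤ) + ((i2:ℕ):ℤ) + ((a:ℕ):ℤ) - ((j2:ℕ):ℤ) - ((j1:ℕ):ℤ) - ((c:ℕ):ℤ)) =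
    (((i1:ℕ):ℤ) + ((i2:ℕ):ℤ) + ((a:ℕ):ℤ) - ((j1:ℕ):ℤ) - ((j2:ℕ):ℤ) - ((c:ℕ):ℤ)) := by ring
  have c4 : (((i2:ℕ):ℤ) + ((i1:ℕ):ℤ) + ((a:ℕ):ℤ) - ((j2:ℕ):ℤ) - ((j1:ℕ):ℤ) - ((c:ℕ):ℤ)) =
    (((i1:ℕ):ℤ) + ((i2:ℕ):ℤ) + ((a:ℕ):ℤ) - ((j1:ℕ):ℤ) - ((j2:ℕ):ℤ) - ((c:ℕ):ℤ)) := by ring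
  rw [c2, c3, c4, sub_right_comm (((a:ℕ):ℤ) + ((i1:ℕ):ℤ)) ((j2:ℕ):ℤ), sub_right_comm (((a:ℕ):ℤ) + ((i2:ℕ):ℤ)) ((j2:ℕ):ℤ)]
  split_ifs
  · rw [← mul_add, ← mul_add, f]
  · rfl

lemma fourTerm_gauge {N : ℕ} {L L' R R' : Matrix (Fin N × Fin N) (Fin N × Fin N) ℂ} (d : Fin N → ℂ) (hd : ∀ i, d i ≠ 0)
    (s s' : ℂ) (hR : ∀ p q, R p q = s * (d p.1 * d p.2 * L p q * (d q.1 * d q.2)⁻¹))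
    (hR' : ∀ p q, R' p q = s' * (d p.1 * d p.2 * L' p q * (d q.1 * d q.2)⁻¹))
    (h : FourTerm L L') : FourTerm R R' := by
  have key : ∀ i1 i2 j1 j2 a c, ∑ x, R (i1, a) (j1, x) * R' (i2, x) (j2, c) =
      s * s' * (d i1 * d i2 * d a * (d j1)⁻¹ * (d j2)⁻¹ * (d c)⁻¹) * ∑ x, L (i1, a) (j1, x) * L' (i2, x) (j2, c) := by
    intro i1 i2 j1 j2 a c
    rw [Finset.mul_sum]
    refine Finset.sum_congr rfl fun x _ => ?_
    rw [hR, hR', mul_inv, mul_inv]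
    have := mul_inv_cancel₀ (hd x)
    simp only
    linear_combination (s * s' * (d i1 * d i2 * d a * (d j1)⁻¹ * (d j2)⁻¹ * (d c)⁻¹) * (L (i1, a) (j1, x) * L' (i2, x) (j2, c))) * this
  intro i1 i2 j1 j2 a c
  rw [key, key, key, key]
  linear_combination (s * s' * (d i1 * d i2 * d a * (d j1)⁻¹ * (d j2)⁻¹ * (d c)⁻¹)) * h i1 i2 j1 j2 a c

lemma Rhat_apply (N : ℕ) (ζ τ ξ : ℂ) : ∃ s : ℂ, ∀ p q, Rhat N ξ ζ τ p q =
    s * (eπ ((((p.1 : ℕ) : ℂ) + 1) / N) * eπ ((((p.2 : ℕ) : ℂ) + 1) / N) * Lm N ξ ζ τ p q *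
      (eπ ((((q.1 : ℕ) : ℂ) + 1) / N) * eπ ((((q.2 : ℕ) : ℂ) + 1) / N))⁻¹) := by
  refine ⟨tauNe N ζ (ζ / 2 - ξ) * (eπ (ξ * (2 / N - 2)) * (kappaNum N ξ ζ τ / kappaDen N ξ ζ τ) *
      jTheta (1/2) (1/2) ζ τ / jTheta (1/2) (1/2) (ξ + ζ) τ), fun p q => ?_⟩
  set d : Fin N → ℂ := fun j => eπ ((((j : ℕ) : ℂ) + 1) / N) with hd
  have hdne : ∀ j, d j ≠ 0 := fun j => Complex.exp_ne_zero _
  have hG : gHalf N ⊗ₖ gHalf N = Matrix.diagonal fun p : Fin N × Fin N => d p.1 * d p.2 := by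
    rw [gHalf, Matrix.diagonal_kronecker_diagonal]
  have hGi : (gHalf N ⊗ₖ gHalf N)⁻¹ = Matrix.diagonal fun p : Fin N × Fin N => (d p.1 * d p.2)⁻¹ := by
    rw [hG]
    apply Matrix.inv_eq_right_inv
    rw [Matrix.diagonal_mul_diagonal, ← Matrix.diagonal_one]
    congr 1
    funext p
    exact mul_inv_cancel₀ (mul_ne_zero (hdne _) (hdne _))
  rw [Rhat, Rmat, hGi, hG, Matrix.smul_apply, Matrix.mul_diagonal, Matrix.diagonal_mul, Zmat, Matrix.smul_apply, ← Lm]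
  simp only [smul_eq_mul]
  ring

lemma HZ_of {N : ℕ} (hN : N ≠ 0) {ζ τ : ℂ}
    (h : ∀ α : Fin N × Fin N,
      jTheta (1/2 + (α.1 : ℕ) / N) (1/2 + (α.2 : ℕ) / N) (ζ / N) τ ≠ 0) : HZ N ζ τ := by
  have hNc : (N:ℂ) ≠ 0 := by exact_mod_cast hN
  intro n k hk
  obtain ⟨x, c, hc⟩ := fin_exists hN n
  have := h (x, ⟨k, hk⟩)
  rw [jTheta_char (((x:ℕ):ℝ) / N) (((k:ℕ):ℝ) / N)] at this
  have h2 := right_ne_zero_of_mul this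
  have hn : (n:ℂ) = (x:ℕ) - N * c := by
    have : n = (x:ℕ) - N * c := by linarith
    rw [this]; push_cast; ring
  have e : (ζ + n * τ + (k:ℕ)) / N = (ζ / N + ((((x:ℕ):ℝ) / N : ℝ):ℂ) * τ + ((((k:ℕ):ℝ) / N : ℝ):ℂ)) + (-c : ℤ) * τ := by
    rw [hn]; push_cast; field_simp; ring
  rw [e, th_add_int_tau]
  exact mul_ne_zero (Complex.exp_ne_zero _) h2

lemma Rhat_fourTerm {N : ℕ} (hN : N ≠ 0) {ζ τ : ℂ} (hτ : 0 < τ.im) (hz : HZ N ζ τ) (u : ℂ) :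
    FourTerm (Rhat N u ζ τ) (Rhat N (u - ζ) ζ τ) := by
  obtain ⟨s, hs⟩ := Rhat_apply N ζ τ u
  obtain ⟨s', hs'⟩ := Rhat_apply N ζ τ (u - ζ)
  exact fourTerm_gauge (fun j : Fin N => eπ ((((j : ℕ) : ℂ) + 1) / N)) (fun j => Complex.exp_ne_zero _) s s' hs hs'
    (Lm_fourTerm hN hτ hz u)
end

/-- Fused antisymmetrizer identity:
`R̂₁₀(z) R̂₂₀(q⁻¹z) ⋯ R̂ₖ₀(q^{1-k}z) A_k = A_k R̂₁₀(z) ⋯ R̂ₖ₀(q^{1-k}z) A_k`,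
the `i`-th factor acting at argument `q^{1-i}z = eπ (ξ - (i-1)ζ)`. -/
theorem fused_antisymmetrizer_Rhat (N k : ℕ) (hN : 2 ≤ N) (hk2 : 2 ≤ k) (hkN : k ≤ N)
    (ξ ζ τ : ℂ) (hτ : 0 < τ.im) (hζ : 0 < ζ.im)
    (hgen : ∀ i : Fin k, Rgeneric N (ξ - i * ζ) ζ τ) :
    (List.ofFn fun i : Fin k =>
        act2 (Fin.castSucc i) (Fin.last k) (Rhat N (ξ - i * ζ) ζ τ)).prod * asymExt N k =
      asymExt N k * (List.ofFn fun i : Fin k =>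
        act2 (Fin.castSucc i) (Fin.last k) (Rhat N (ξ - i * ζ) ζ τ)).prod * asymExt N k := by
  have hN0 : N ≠ 0 := by omega
  have hz : HZ N ζ τ := HZ_of hN0 (hgen ⟨0, by omega⟩).2.1
  refine fused_of_fourTerm N k (fun i : Fin k => Rhat N (ξ - i * ζ) ζ τ) fun i hi => ?_
  have h := Rhat_fourTerm hN0 hτ hz (ξ - i * ζ)
  have e : ξ - i * ζ - ζ = ξ - ((i + 1 : ℕ) : ℂ) * ζ := by push_cast; ring
  rw [e] at h
  exact h

end
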